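/- arXiv:1302.5658 — 2 statements merged into one kernel-verified Lean document; each statement's English description precedes it below -/
import Mathlib

section
/- cov(σG₀) ≤ add(M), where σG₀ is the σ-ideal generated by minimal dense G_δ-subsets of the Hilbert cube I^ω and M is the σ-ideal of meager subsets of I^ω. -/
open Set Topology Cardinal

/-- The Hilbert cube `[0,1]^ℕ` with the product topology. -/
abbrev HilbertCube : Type := ℕ → ↥(Set.Icc (0:ℝ) 1)

/-- An ideal of subsets: a nonempty family closed under subsets and finite unions. -/
def IsIdeal {X : Type*} (I : Set (Set X)) : Prop :=
  I.Nonempty ∧ (∀ A ∈ I, ∀ B, B ⊆ A → B ∈ I) ∧ (∀ A ∈ I, ∀ B ∈ I, A ∪ B ∈ I)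

/-- A σ-ideal: an ideal closed under countable unions. -/
def IsSigmaIdeal {X : Type*} (I : Set (Set X)) : Prop :=
  IsIdeal I ∧ ∀ A : ℕ → Set X, (∀ n, A n ∈ I) → (⋃ n, A n) ∈ I

/-- A non-trivial ideal contains an uncountable set but not the whole space. -/
def NontrivialIdeal {X : Type*} (I : Set (Set X)) : Prop :=
  (∃ A ∈ I, ¬ A.Countable) ∧ Set.univ ∉ I

/-- An ideal on a topological space is topologically invariant if it is preserved by
all homeomorphisms of the space. -/
def TopInvariant {X : Type*} [TopologicalSpace X] (I : Set (Set X)) : Prop :=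
  ∀ h : X ≃ₜ X, {B | ∃ A ∈ I, B = h '' A} = I

/-- `I` has a base all of whose members satisfy `P`. -/
def HasBaseWith {X : Type*} (I : Set (Set X)) (P : Set X → Prop) : Prop :=
  ∃ B ⊆ I, (∀ A ∈ I, ∃ C ∈ B, A ⊆ C) ∧ ∀ C ∈ B, P C

/-- A set has the Baire property if it differs from some open set by a meager set. -/
def HasBaireProperty {X : Type*} [TopologicalSpace X] (A : Set X) : Prop :=
  ∃ U : Set X, IsOpen U ∧ IsMeagre ((A \ U) ∪ (U \ A))

/-- The σ-ideal of meager subsets of a topological space. -/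
def MeagerIdeal (X : Type*) [TopologicalSpace X] : Set (Set X) := {A | IsMeagre A}

/-- The σ-ideal generated by a family `F`: all subsets of countable unions of members
of `F`. -/
def sigmaGenerated {X : Type*} (F : Set (Set X)) : Set (Set X) :=
  {A | ∃ S : ℕ → Set X, (∀ n, S n ∈ F) ∧ A ⊆ ⋃ n, S n}

/-- A Cantor set in the Hilbert cube: a subset homeomorphic to the Cantor cube. -/
def IsCantorSet (C : Set HilbertCube) : Prop := Nonempty (C ≃ₜ (ℕ → Bool))

/-- A minimal Cantor set: one that can be mapped into any other Cantor set by an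
ambient homeomorphism. -/
def IsMinimalCantorSet (A : Set HilbertCube) : Prop :=
  IsCantorSet A ∧ ∀ B : Set HilbertCube, IsCantorSet B →
    ∃ h : HilbertCube ≃ₜ HilbertCube, h '' A ⊆ B

/-- The family of all minimal Cantor sets in the Hilbert cube. -/
def CantorFamily : Set (Set HilbertCube) := {A | IsMinimalCantorSet A}

/-- The σ-ideal generated by minimal Cantor sets. -/
def sigmaC0 : Set (Set HilbertCube) := sigmaGenerated CantorFamily

/-- A minimal dense Gδ-subset of the Hilbert cube. -/
def IsMinimalDenseGdelta (A : Set HilbertCube) : Prop :=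
  IsGδ A ∧ Dense A ∧ ∀ B : Set HilbertCube, IsGδ B → Dense B →
    ∃ h : HilbertCube ≃ₜ HilbertCube, h '' A ⊆ B

/-- The family of all minimal dense Gδ-sets in the Hilbert cube. -/
def GdeltaFamily : Set (Set HilbertCube) := {A | IsMinimalDenseGdelta A}

/-- The σ-ideal generated by minimal dense Gδ-sets. -/
def sigmaG0 : Set (Set HilbertCube) := sigmaGenerated GdeltaFamily

/-- `cov(I)`: the least cardinality of a subfamily of `I` covering the space. -/
noncomputable def covIdeal {X : Type*} (I : Set (Set X)) : Cardinal :=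
  sInf {c | ∃ A : Set (Set X), A ⊆ I ∧ ⋃₀ A = Set.univ ∧ c = #A}

/-- `non(I)`: the least cardinality of a subset of the space not in `I`. -/
noncomputable def nonIdeal {X : Type*} (I : Set (Set X)) : Cardinal :=
  sInf {c | ∃ A : Set X, A ∉ I ∧ c = #A}

/-- `add(I,J)`: the least cardinality of a subfamily of `I` whose union is not in `J`. -/
noncomputable def addIdeal2 {X : Type*} (I J : Set (Set X)) : Cardinal :=
  sInf {c | ∃ A : Set (Set X), A ⊆ I ∧ ⋃₀ A ∉ J ∧ c = #A}

/-- `add(I) = add(I,I)`. -/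
noncomputable def addIdeal {X : Type*} (I : Set (Set X)) : Cardinal := addIdeal2 I I

/-- `cof(I,J)`: the least cardinality of a subfamily of `J` cofinal in `I`. -/
noncomputable def cofIdeal2 {X : Type*} (I J : Set (Set X)) : Cardinal :=
  sInf {c | ∃ A : Set (Set X), A ⊆ J ∧ (∀ B ∈ I, ∃ C ∈ A, B ⊆ C) ∧ c = #A}

/-- `cof(I) = cof(I,I)`. -/
noncomputable def cofIdeal {X : Type*} (I : Set (Set X)) : Cardinal := cofIdeal2 I I

/-- The compact-open topology on the homeomorphism group of a space, induced by the
compact-open topology of the space of continuous self-maps. -/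
noncomputable instance homeoGroupTopology (X : Type*) [TopologicalSpace X] :
    TopologicalSpace (X ≃ₜ X) :=
  TopologicalSpace.induced (fun h : X ≃ₜ X => (⟨h, h.continuous⟩ : C(X, X)))
    ContinuousMap.compactOpen

/-- A Z-set: a closed set `A` such that for every open cover `U` of the space there is a
continuous map into the complement of `A` which is `U`-near to the identity. -/
def IsZSet {X : Type*} [TopologicalSpace X] (A : Set X) : Prop :=
  IsClosed A ∧ ∀ U : Set (Set X), (∀ V ∈ U, IsOpen V) → ⋃₀ U = Set.univ →
    ∃ f : C(X, X), (∀ x, f x ∉ A) ∧ ∀ x : X, ∃ V ∈ U, x ∈ V ∧ f x ∈ V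

/-- A σZ-set: a countable union of Z-sets. -/
def IsSigmaZSet {X : Type*} [TopologicalSpace X] (A : Set X) : Prop :=
  ∃ Z : ℕ → Set X, (∀ n, IsZSet (Z n)) ∧ A = ⋃ n, Z n

/-- The cube `[0,1]^n`. -/
abbrev FinCube (n : ℕ) : Type := Fin n → ↥(Set.Icc (0:ℝ) 1)

/-- A `Z_n`-set in the Hilbert cube: a closed set `A` such that maps avoiding `A` are
dense in the space `C([0,1]^n, I^ω)` with the compact-open topology. -/
def IsZnSet (n : ℕ) (A : Set HilbertCube) : Prop :=
  IsClosed A ∧ Dense {f : C(FinCube n, HilbertCube) | ∀ x, f x ∉ A}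

/-- A `Z_ω`-set in the Hilbert cube: a closed set which is a `Z_n`-set for all `n`. -/
def IsZomegaSet (A : Set HilbertCube) : Prop :=
  IsClosed A ∧ ∀ n : ℕ, IsZnSet n A

/-- Covering dimension of a space is at most `n`: every finite open cover has a finite
open refinement (still a cover) in which no point belongs to more than `n+1` members. -/
def CovDimLE (Y : Type*) [TopologicalSpace Y] (n : ℕ) : Prop :=
  ∀ U : Set (Set Y), U.Finite → (∀ V ∈ U, IsOpen V) → ⋃₀ U = Set.univ →
    ∃ V : Set (Set Y), V.Finite ∧ (∀ W ∈ V, IsOpen W) ∧ ⋃₀ V = Set.univ ∧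
      (∀ W ∈ V, ∃ W' ∈ U, W ⊆ W') ∧
      ∀ y : Y, {W ∈ V | y ∈ W}.ncard ≤ n + 1

/-- A `G_δ`-generated topologically invariant ideal on the Hilbert cube. -/
def GdeltaGenerated (I : Set (Set HilbertCube)) : Prop :=
  HasBaseWith I IsSigmaCompact ∧
  ∃ G : Set HilbertCube, IsGδ G ∧
    (∀ K : Set HilbertCube, K ⊆ G → IsCompact K → K ∈ I) ∧
    ∀ A ∈ I, IsCompact A →
      Dense {h : HilbertCube ≃ₜ HilbertCube | h '' A ⊆ G}

/-- A `G_δ*`-generated ideal: a preimage of a `G_δ`-generated ideal under an embedding. -/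
def GdeltaStarGenerated (I : Set (Set HilbertCube)) : Prop :=
  ∃ I' : Set (Set HilbertCube), GdeltaGenerated I' ∧
    ∃ e : HilbertCube → HilbertCube, IsEmbedding e ∧ I = {S | ∃ A ∈ I', S = e ⁻¹' A}

/-- A `σG_δ*`-generated ideal. -/
def SigmaGdeltaStarGenerated (I : Set (Set HilbertCube)) : Prop :=
  ∃ In : ℕ → Set (Set HilbertCube), (∀ n, GdeltaStarGenerated (In n)) ∧
    (∀ n, In n ⊆ I) ∧
    ∀ A ∈ I, ∃ K : ℕ → Set HilbertCube,
      (∀ n, IsCompact (K n) ∧ K n ∈ In n) ∧ A ⊆ ⋃ n, K n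

/-- The piecewise linear shear of the plane fixing the left half plane. -/
def planeShear (c : ℝ) (v : ℝ × ℝ) : ℝ × ℝ := (v.1, v.2 + c * max v.1 0)

theorem planeShear_neg_planeShear (c : ℝ) (v : ℝ × ℝ) :
    planeShear (-c) (planeShear c v) = v := by
  simp [planeShear]

theorem planeShear_smul (c : ℝ) {t : ℝ} (ht : 0 ≤ t) (v : ℝ × ℝ) :
    planeShear c (t • v) = t • planeShear c v := by
  have : max (t * v.1) 0 = t * max v.1 0 := by
    rw [mul_max_of_nonneg _ _ ht, mul_zero]
  ext
  · simp [planeShear]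
  · simp only [planeShear, Prod.smul_fst, Prod.smul_snd, smul_eq_mul, this]; ring

theorem continuous_planeShear (c : ℝ) : Continuous (planeShear c) := by
  unfold planeShear; fun_prop

theorem planeShear_zero (c : ℝ) : planeShear c 0 = 0 := by simp [planeShear]

theorem planeShear_ne_zero (c : ℝ) {v : ℝ × ℝ} (hv : v ≠ 0) : planeShear c v ≠ 0 := by
  intro h
  apply hv
  rw [← planeShear_neg_planeShear c v, h, planeShear_zero]

/-- The shear rescaled radially so that it preserves the supremum norm. -/
noncomputable def radialShear (c : ℝ) (v : ℝ × ℝ) : ℝ × ℝ :=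
  (‖v‖ / ‖planeShear c v‖) • planeShear c v

theorem norm_radialShear (c : ℝ) (v : ℝ × ℝ) : ‖radialShear c v‖ = ‖v‖ := by
  rcases eq_or_ne v 0 with rfl | hv
  · simp [radialShear]
  · have := norm_ne_zero_iff.2 (planeShear_ne_zero c hv)
    rw [radialShear, norm_smul, norm_div, norm_norm, norm_norm, div_mul_cancel₀ _ this]

theorem radialShear_neg_radialShear (c : ℝ) (v : ℝ × ℝ) :
    radialShear (-c) (radialShear c v) = v := by
  rcases eq_or_ne v 0 with rfl | hv
  · simp [radialShear]
  · have h1 := norm_ne_zero_iff.2 (planeShear_ne_zero c hv)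
    have h2 := norm_ne_zero_iff.2 hv
    have h3 : planeShear (-c) (radialShear c v) = (‖v‖ / ‖planeShear c v‖) • v := by
      rw [radialShear, planeShear_smul _ (by positivity), planeShear_neg_planeShear]
    rw [radialShear, norm_radialShear, h3, norm_smul, norm_div, norm_norm, norm_norm, smul_smul]
    have : ‖v‖ / (‖v‖ / ‖planeShear c v‖ * ‖v‖) * (‖v‖ / ‖planeShear c v‖) = 1 := by
      field_simp
    rw [this, one_smul]

theorem continuous_radialShear (c : ℝ) : Continuous (radialShear c) := by
  rw [continuous_iff_continuousAt]
  intro v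
  rcases eq_or_ne v 0 with rfl | hv
  · have h0 : radialShear c 0 = 0 := by simp [radialShear]
    rw [ContinuousAt, h0, tendsto_zero_iff_norm_tendsto_zero]
    simp_rw [norm_radialShear]
    simpa using (continuous_norm (E := ℝ × ℝ)).tendsto 0
  · have h1 := norm_ne_zero_iff.2 (planeShear_ne_zero c hv)
    have h2 := (continuous_planeShear c).continuousAt (x := v)
    exact (continuousAt_id.norm.div h2.norm h1).smul h2

theorem radialShear_of_nonpos (c : ℝ) {v : ℝ × ℝ} (hv : v.1 ≤ 0) : radialShear c v = v := by
  have h : planeShear c v = v := by simp [planeShear, hv]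
  rcases eq_or_ne v 0 with rfl | h0
  · simp [radialShear]
  · rw [radialShear, h, div_self (norm_ne_zero_iff.2 h0), one_smul]

theorem radialShear_fst_pos (c : ℝ) {v : ℝ × ℝ} (hv : 0 < v.1) : 0 < (radialShear c v).1 := by
  have h0 : v ≠ 0 := by rintro rfl; simp at hv
  have h1 := norm_pos_iff.2 (planeShear_ne_zero c h0)
  have h2 := norm_pos_iff.2 h0
  have : (planeShear c v).1 = v.1 := rfl
  simp only [radialShear, Prod.smul_fst, smul_eq_mul, this]
  positivity

theorem radialShear_slope (c : ℝ) {v : ℝ × ℝ} (hv : 0 < v.1) :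
    (radialShear c v).2 / (radialShear c v).1 = v.2 / v.1 + c := by
  have h0 : v ≠ 0 := by rintro rfl; simp at hv
  have h1 := norm_pos_iff.2 (planeShear_ne_zero c h0)
  have h2 := norm_pos_iff.2 h0
  have h3 : 0 < ‖v‖ / ‖planeShear c v‖ := by positivity
  simp only [radialShear, Prod.smul_fst, Prod.smul_snd, smul_eq_mul]
  rw [mul_div_mul_left _ _ h3.ne']
  simp only [planeShear, max_eq_left hv.le]
  field_simp

/-- Coordinates on the square in which the vertical line at `l` is the axis of the twist. -/
noncomputable def twistCoord (l : ℝ) (v : Icc (0:ℝ) 1 × Icc (0:ℝ) 1) : ℝ × ℝ :=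
  ((l - v.1) / l, 2 * v.2 - 1)

/-- The inverse of `twistCoord`. -/
noncomputable def twistPoint (l : ℝ) (w : ℝ × ℝ) : Icc (0:ℝ) 1 × Icc (0:ℝ) 1 :=
  (projIcc 0 1 zero_le_one (l - l * w.1), projIcc 0 1 zero_le_one ((w.2 + 1) / 2))

theorem twistPoint_twistCoord {l : ℝ} (hl : 0 < l) (v : Icc (0:ℝ) 1 × Icc (0:ℝ) 1) :
    twistPoint l (twistCoord l v) = v := by
  have h1 : l - l * ((l - v.1) / l) = v.1 := by field_simp; ring
  have h2 : (2 * (v.2 : ℝ) - 1 + 1) / 2 = v.2 := by ring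
  simp only [twistPoint, twistCoord, h1, h2, projIcc_val]

theorem twistCoord_twistPoint {l : ℝ} (hl : 0 < l) {w : ℝ × ℝ}
    (h1 : l - l * w.1 ∈ Icc (0:ℝ) 1) (h2 : (w.2 + 1) / 2 ∈ Icc (0:ℝ) 1) :
    twistCoord l (twistPoint l w) = w := by
  simp only [twistPoint, twistCoord, projIcc_of_mem _ h1, projIcc_of_mem _ h2]
  ext
  · simp; field_simp
  · simp; ring

theorem radialShear_twistCoord_mem {l : ℝ} (hl : 0 < l) (hl' : l < 1) (c : ℝ)
    (v : Icc (0:ℝ) 1 × Icc (0:ℝ) 1) :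
    l - l * (radialShear c (twistCoord l v)).1 ∈ Icc (0:ℝ) 1 ∧
      ((radialShear c (twistCoord l v)).2 + 1) / 2 ∈ Icc (0:ℝ) 1 := by
  obtain ⟨⟨a, ha0, ha1⟩, ⟨b, hb0, hb1⟩⟩ := v
  rcases le_or_gt l a with h | h
  · have : (twistCoord l (⟨a, ha0, ha1⟩, ⟨b, hb0, hb1⟩)).1 ≤ 0 :=
      div_nonpos_of_nonpos_of_nonneg (by simpa using h) hl.le
    rw [radialShear_of_nonpos c this]
    simp only [twistCoord, mem_Icc]
    have h1 : l - l * ((l - a) / l) = a := by field_simp; ring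
    rw [h1]
    refine ⟨⟨ha0, ha1⟩, ?_, ?_⟩ <;> linarith
  · have hx : 0 < (twistCoord l (⟨a, ha0, ha1⟩, ⟨b, hb0, hb1⟩)).1 :=
      div_pos (by simpa using h) hl
    have hp := radialShear_fst_pos c hx
    have hn : ‖radialShear c (twistCoord l (⟨a, ha0, ha1⟩, ⟨b, hb0, hb1⟩))‖ ≤ 1 := by
      rw [norm_radialShear, Prod.norm_def, max_le_iff]
      constructor
      · rw [Real.norm_of_nonneg hx.le]
        simp only [twistCoord]
        rw [div_le_one hl]; linarith
      · simp only [twistCoord, Real.norm_eq_abs]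
        rw [abs_le]; constructor <;> linarith
    generalize radialShear c (twistCoord l (⟨a, ha0, ha1⟩, ⟨b, hb0, hb1⟩)) = w at *
    rw [Prod.norm_def, max_le_iff, Real.norm_eq_abs, Real.norm_eq_abs, abs_le, abs_le] at hn
    refine ⟨⟨?_, ?_⟩, ?_, ?_⟩
    · nlinarith
    · nlinarith
    · linarith
    · linarith

/-- The twist of the square along the side `v.1 = 0`, fixing the points with `l ≤ v.1`. -/
noncomputable def leftTwist {l : ℝ} (hl : 0 < l) (hl' : l < 1) (c : ℝ) :
    Icc (0:ℝ) 1 × Icc (0:ℝ) 1 ≃ₜ Icc (0:ℝ) 1 × Icc (0:ℝ) 1 where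
  toFun v := twistPoint l (radialShear c (twistCoord l v))
  invFun v := twistPoint l (radialShear (-c) (twistCoord l v))
  left_inv v := by
    have h := radialShear_twistCoord_mem hl hl' c v
    simp only [twistCoord_twistPoint hl h.1 h.2, radialShear_neg_radialShear,
      twistPoint_twistCoord hl]
  right_inv v := by
    have h := radialShear_twistCoord_mem hl hl' (-c) v
    have h2 := radialShear_neg_radialShear (-c)
    rw [neg_neg] at h2
    simp only [twistCoord_twistPoint hl h.1 h.2, h2, twistPoint_twistCoord hl]
  continuous_toFun := by
    have := continuous_radialShear c
    have h0 : Continuous (twistCoord l) := by unfold twistCoord; fun_prop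
    have h1 : Continuous (twistPoint l) := by
      unfold twistPoint
      exact (continuous_projIcc.comp (by fun_prop)).prodMk (continuous_projIcc.comp (by fun_prop))
    exact h1.comp (this.comp h0)
  continuous_invFun := by
    have := continuous_radialShear (-c)
    have h0 : Continuous (twistCoord l) := by unfold twistCoord; fun_prop
    have h1 : Continuous (twistPoint l) := by
      unfold twistPoint
      exact (continuous_projIcc.comp (by fun_prop)).prodMk (continuous_projIcc.comp (by fun_prop))
    exact h1.comp (this.comp h0)

theorem exists_leftTwist {l : ℝ} (hl : 0 < l) (hl' : l < 1) :
    ∃ (T : Icc (0:ℝ) 1 × Icc (0:ℝ) 1 ≃ₜ Icc (0:ℝ) 1 × Icc (0:ℝ) 1)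
      (Φ : Icc (0:ℝ) 1 × Icc (0:ℝ) 1 → ℝ),
      (∀ v, l ≤ v.1 → T v = v) ∧ (∀ v, (v.1 : ℝ) < l → ((T v).1 : ℝ) < l) ∧
      (∀ v, (v.1 : ℝ) < l → Φ (T v) = Φ v + 1) ∧
      ∀ v, (v.1 : ℝ) < l → |Φ v| * (l - v.1) ≤ 1 := by
  have hT : ∀ v, twistCoord l (leftTwist hl hl' 1 v) = radialShear 1 (twistCoord l v) := fun v =>
    have h := radialShear_twistCoord_mem hl hl' 1 v
    twistCoord_twistPoint hl h.1 h.2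
  have hpos : ∀ v : Icc (0:ℝ) 1 × Icc (0:ℝ) 1, 0 < (twistCoord l v).1 ↔ (v.1 : ℝ) < l := by
    intro v
    simp only [twistCoord]
    rw [div_pos_iff_of_pos_right hl, sub_pos]
  refine ⟨leftTwist hl hl' 1, fun v => (twistCoord l v).2 / (twistCoord l v).1, ?_, ?_, ?_, ?_⟩
  · intro v hv
    have : (twistCoord l v).1 ≤ 0 := not_lt.1 fun h => absurd ((hpos v).1 h) (not_lt.2 hv)
    change twistPoint l (radialShear 1 (twistCoord l v)) = v
    rw [radialShear_of_nonpos _ this, twistPoint_twistCoord hl]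
  · intro v hv
    rw [← hpos, hT]
    exact radialShear_fst_pos _ ((hpos v).2 hv)
  · intro v hv
    simp only [hT]
    exact radialShear_slope 1 ((hpos v).2 hv)
  · intro v hv
    have h1 : 0 < l - v.1 := sub_pos.2 hv
    have h2 : |2 * (v.2 : ℝ) - 1| ≤ 1 := by
      have := v.2.2.1; have := v.2.2.2
      rw [abs_le]; constructor <;> linarith
    simp only [twistCoord]
    rw [div_div_eq_mul_div, abs_div, abs_mul, abs_of_pos h1, abs_of_pos hl, div_mul_cancel₀ _ h1.ne']
    nlinarith

theorem exists_rightTwist {u : ℝ} (hu : 0 < u) (hu' : u < 1) :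
    ∃ (T : Icc (0:ℝ) 1 × Icc (0:ℝ) 1 ≃ₜ Icc (0:ℝ) 1 × Icc (0:ℝ) 1)
      (Φ : Icc (0:ℝ) 1 × Icc (0:ℝ) 1 → ℝ),
      (∀ v, (v.1 : ℝ) ≤ u → T v = v) ∧ (∀ v, u < v.1 → u < (T v).1) ∧
      (∀ v, u < v.1 → Φ (T v) = Φ v + 1) ∧
      ∀ v, u < v.1 → |Φ v| * (v.1 - u) ≤ 1 := by
  obtain ⟨T, Φ, h1, h2, h3, h4⟩ := exists_leftTwist (sub_pos.2 hu') (sub_lt_self 1 hu)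
  let σ : Icc (0:ℝ) 1 × Icc (0:ℝ) 1 ≃ₜ Icc (0:ℝ) 1 × Icc (0:ℝ) 1 :=
    unitInterval.symmHomeomorph.prodCongr (Homeomorph.refl _)
  have hσ : ∀ v, ((σ v).1 : ℝ) = 1 - v.1 := fun v => rfl
  have hσσ : ∀ v, σ (σ v) = v := fun v => by
    ext
    · simp [hσ]
    · rfl
  refine ⟨(σ.trans T).trans σ, Φ ∘ σ, fun v hv => ?_, fun v hv => ?_, fun v hv => ?_,
    fun v hv => ?_⟩
  · change σ (T (σ v)) = v
    rw [h1 _ (by rw [hσ]; linarith), hσσ]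
  · change u < (σ (T (σ v))).1
    have := h2 (σ v) (by rw [hσ]; linarith)
    rw [hσ]; linarith
  · change Φ (σ (σ (T (σ v)))) = Φ (σ v) + 1
    rw [hσσ, h3 _ (by rw [hσ]; linarith)]
  · have := h4 (σ v) (by rw [hσ]; linarith)
    rw [hσ, sub_sub_sub_cancel_left] at this
    exact this

theorem exists_intervalPush {S : Set (Icc (0:ℝ) 1)}
    (h0 : (⟨0, by simp⟩ : Icc (0:ℝ) 1) ∈ S) (h1 : (⟨1, by simp⟩ : Icc (0:ℝ) 1) ∈ S) :
    ∃ T : Icc (0:ℝ) 1 ≃ₜ Icc (0:ℝ) 1, Monotone T ∧ (∀ s ∈ S, T s = s) ∧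
      ∀ a, (T a : ℝ) = a - Metric.infDist a S / 2 := by
  have hle : ∀ a : Icc (0:ℝ) 1, Metric.infDist a S ≤ a := fun a => by
    refine (Metric.infDist_le_dist_of_mem h0).trans ?_
    rw [Subtype.dist_eq, Real.dist_eq, sub_zero, abs_of_nonneg a.2.1]
  have hlip : ∀ a b : Icc (0:ℝ) 1, Metric.infDist b S ≤ Metric.infDist a S + |(b:ℝ) - a| := by
    intro a b
    have := Metric.infDist_le_infDist_add_dist (s := S) (x := b) (y := a)
    rwa [Subtype.dist_eq, Real.dist_eq] at this
  let f : Icc (0:ℝ) 1 → Icc (0:ℝ) 1 := fun a => ⟨a - Metric.infDist a S / 2, by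
    have := hle a; have := a.2.1; linarith, by
    have := Metric.infDist_nonneg (x := a) (s := S); have := a.2.2; linarith⟩
  have hmono : StrictMono f := by
    intro a b hab
    have h : (a : ℝ) < b := hab
    have := hlip a b
    rw [abs_of_pos (sub_pos.2 h)] at this
    change (a : ℝ) - Metric.infDist a S / 2 < b - Metric.infDist b S / 2
    linarith
  have hfix : ∀ s ∈ S, f s = s := by
    intro s hs
    ext
    simp [f, Metric.infDist_zero_of_mem hs]
  have hcont : Continuous f := by
    refine Continuous.subtype_mk ?_ _
    exact continuous_subtype_val.sub ((Metric.continuous_infDist_pt S).div_const 2)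
  have hsurj : Function.Surjective f := fun c => by
    refine mem_range_of_exists_le_of_exists_ge hcont ⟨_, (hfix _ h0).le.trans ?_⟩
      ⟨_, le_trans ?_ (hfix _ h1).ge⟩
    · exact c.2.1
    · exact c.2.2
  exact ⟨(hmono.orderIsoOfSurjective f hsurj).toHomeomorph, hmono.monotone, hfix, fun a => rfl⟩

theorem encard_le_of_potential {Φ : ℕ → ℝ} (hΦ : Monotone Φ) {B : Set ℕ} {δ N : ℝ} (hδ : 0 < δ)
    (hB : ∀ k ∈ B, Φ k + δ ≤ Φ (k + 1)) (hN : ∀ k ∈ B, |Φ k| ≤ N) :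
    B.encard ≤ ((⌊2 * N / δ⌋₊ + 1 : ℕ) : ℕ∞) := by
  have hcard : ((Finset.range (⌊2 * N / δ⌋₊ + 1) : Finset ℕ) : Set ℕ).encard
      = ((⌊2 * N / δ⌋₊ + 1 : ℕ) : ℕ∞) := by
    rw [Set.encard_coe_eq_coe_finsetCard, Finset.card_range]
  rw [← hcard]
  refine Set.encard_le_encard_of_injOn (f := fun k => ⌊(Φ k + N) / δ⌋₊) ?_ ?_
  · intro k hk
    have := abs_le.1 (hN k hk)
    simp only [Finset.coe_range, mem_Iio, Nat.lt_succ_iff]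
    apply Nat.floor_mono
    gcongr
    linarith
  · have key : ∀ k ∈ B, ∀ k' ∈ B, k < k' → ⌊(Φ k + N) / δ⌋₊ < ⌊(Φ k' + N) / δ⌋₊ := by
      intro k hk k' hk' hlt
      have h1 := hB k hk
      have h2 := hΦ (Nat.succ_le_of_lt hlt)
      have h3 := abs_le.1 (hN k hk)
      have h4 : (Φ k + N) / δ + 1 ≤ (Φ k' + N) / δ := by
        rw [div_add_one hδ.ne']
        refine (div_le_div_iff_of_pos_right hδ).2 ?_
        simp only [Nat.succ_eq_add_one] at h2
        linarith
      have h5 : 0 ≤ (Φ k + N) / δ := div_nonneg (by linarith) hδ.le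
      have h6 := Nat.floor_mono h4
      rw [Nat.floor_add_one h5] at h6
      omega
    intro k hk k' hk' h
    rcases lt_trichotomy k k' with hlt | rfl | hlt
    · exact absurd h (key k hk k' hk' hlt).ne
    · rfl
    · exact absurd h (key k' hk' k hk hlt).ne'

theorem exists_squarePush {P : Finset (Icc (0:ℝ) 1)} (hP : P.Nonempty)
    (hP01 : ∀ p ∈ P, 0 < (p : ℝ) ∧ (p : ℝ) < 1) {η : ℝ} (hη : 0 < η) :
    ∃ (T : Icc (0:ℝ) 1 × Icc (0:ℝ) 1 ≃ₜ Icc (0:ℝ) 1 × Icc (0:ℝ) 1) (C : ℕ),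
      (∀ p ∈ P, ∀ v, (v.1 ≤ p → (T v).1 ≤ p) ∧ (p ≤ v.1 → p ≤ (T v).1)) ∧
      ∀ v, {k : ℕ | ∀ p ∈ P, η < |((T^[k] v).1 : ℝ) - p|}.encard ≤ C := by
  set l := P.min' hP with hl
  set u := P.max' hP with hu
  have hlP : l ∈ P := P.min'_mem hP
  have huP : u ∈ P := P.max'_mem hP
  have hlu : l ≤ u := P.min'_le _ huP
  have hlu' : (l : ℝ) ≤ u := hlu
  obtain ⟨L, ΦL, L1, L2, L3, L4⟩ := exists_leftTwist (hP01 l hlP).1 (hP01 l hlP).2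
  obtain ⟨R, ΦR, R1, R2, R3, R4⟩ := exists_rightTwist (hP01 u huP).1 (hP01 u huP).2
  let S : Set (Icc (0:ℝ) 1) := (Iic l ∪ P) ∪ Ici u
  obtain ⟨M, M1, M2, M3⟩ := exists_intervalPush (S := S)
    (Or.inl (Or.inl (hP01 l hlP).1.le)) (Or.inr (hP01 u huP).2.le)
  have hPS : ∀ p ∈ P, M p = p := fun p hp => M2 p (Or.inl (Or.inr hp))
  let T := (L.trans (M.prodCongr (Homeomorph.refl _))).trans R
  have hT : ∀ v, T v = R (M (L v).1, (L v).2) := fun v => rfl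
  have TL : ∀ v : Icc (0:ℝ) 1 × Icc (0:ℝ) 1, v.1 < l → T v = L v := by
    intro v hv
    have h2 : (L v).1 < l := L2 v hv
    rw [hT, M2 _ (Or.inl (Or.inl h2.le)), Prod.mk.eta, R1]
    exact (h2.le.trans hlu)
  have TR : ∀ v : Icc (0:ℝ) 1 × Icc (0:ℝ) 1, u < v.1 → T v = R v := by
    intro v hv
    have h2 : L v = v := L1 v (hlu.trans hv.le)
    rw [hT, h2, M2 _ (Or.inr hv.le), Prod.mk.eta]
  have TM : ∀ v : Icc (0:ℝ) 1 × Icc (0:ℝ) 1, l ≤ v.1 → v.1 ≤ u → T v = (M v.1, v.2) := by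
    intro v hv hv'
    have h2 : L v = v := L1 v hv
    rw [hT, h2, R1]
    have := M1 hv'
    rwa [hPS u huP] at this
  have hTL : ∀ v : Icc (0:ℝ) 1 × Icc (0:ℝ) 1, v.1 < l → ∀ k, (T^[k] v).1 < l := by
    intro v hv k
    induction k with
    | zero => exact hv
    | succ k ih =>
      rw [Function.iterate_succ_apply', TL _ ih]
      exact L2 _ ih
  have hTR : ∀ v : Icc (0:ℝ) 1 × Icc (0:ℝ) 1, u < v.1 → ∀ k, u < (T^[k] v).1 := by
    intro v hv k
    induction k with
    | zero => exact hv
    | succ k ih =>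
      rw [Function.iterate_succ_apply', TR _ ih]
      exact R2 _ ih
  have hTM : ∀ v : Icc (0:ℝ) 1 × Icc (0:ℝ) 1, l ≤ v.1 → v.1 ≤ u →
      ∀ k, l ≤ (T^[k] v).1 ∧ (T^[k] v).1 ≤ u := by
    intro v hv hv' k
    induction k with
    | zero => exact ⟨hv, hv'⟩
    | succ k ih =>
      rw [Function.iterate_succ_apply', TM _ ih.1 ih.2]
      have h1 := M1 ih.1
      have h2 := M1 ih.2
      rw [hPS _ hlP] at h1
      rw [hPS _ huP] at h2
      exact ⟨h1, h2⟩
  refine ⟨T, max (⌊2 * (1 / η) / 1⌋₊ + 1) (⌊2 * 1 / (η / 2)⌋₊ + 1), ?_, ?_⟩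
  · intro p hp v
    have hlp : l ≤ p := P.min'_le _ hp
    have hpu : p ≤ u := P.le_max' _ hp
    rcases lt_or_ge v.1 l with h | h
    · have h2 : (L v).1 < l := L2 v h
      rw [TL v h]
      exact ⟨fun _ => h2.le.trans hlp, fun h' => absurd (hlp.trans h') (not_le.2 h)⟩
    rcases lt_or_ge u v.1 with h' | h'
    · have h2 : u < (R v).1 := R2 v h'
      rw [TR v h']
      exact ⟨fun hv => absurd (hv.trans hpu) (not_le.2 h'), fun _ => hpu.trans h2.le⟩
    rw [TM v h h']
    refine ⟨fun hv => ?_, fun hv => ?_⟩ <;>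
    · have := M1 hv
      rwa [hPS p hp] at this
  · intro v
    rcases lt_or_ge v.1 l with h | h
    · refine le_trans ?_ (Nat.cast_le.2 (le_max_left _ _))
      have hstep : ∀ k, ΦL (T^[k + 1] v) = ΦL (T^[k] v) + 1 := fun k => by
        rw [Function.iterate_succ_apply', TL _ (hTL v h k), L3 _ (hTL v h k)]
      refine encard_le_of_potential (Φ := fun k => ΦL (T^[k] v)) ?_ one_pos ?_ ?_
      · exact monotone_nat_of_le_succ fun k => by rw [hstep]; linarith
      · exact fun k _ => (hstep k).ge
      · intro k hk
        have h1 := hk l hlP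
        have h2 : ((T^[k] v).1 : ℝ) < l := hTL v h k
        have h3 := L4 _ h2
        rw [abs_sub_comm, abs_of_pos (sub_pos.2 h2)] at h1
        rw [le_div_iff₀ hη]
        exact (mul_le_mul_of_nonneg_left h1.le (abs_nonneg _)).trans h3
    rcases lt_or_ge u v.1 with h' | h'
    · refine le_trans ?_ (Nat.cast_le.2 (le_max_left _ _))
      have hstep : ∀ k, ΦR (T^[k + 1] v) = ΦR (T^[k] v) + 1 := fun k => by
        rw [Function.iterate_succ_apply', TR _ (hTR v h' k), R3 _ (hTR v h' k)]
      refine encard_le_of_potential (Φ := fun k => ΦR (T^[k] v)) ?_ one_pos ?_ ?_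
      · exact monotone_nat_of_le_succ fun k => by rw [hstep]; linarith
      · exact fun k _ => (hstep k).ge
      · intro k hk
        have h1 := hk u huP
        have h2 : (u : ℝ) < (T^[k] v).1 := hTR v h' k
        have h3 := R4 _ h2
        rw [abs_of_pos (sub_pos.2 h2)] at h1
        rw [le_div_iff₀ hη]
        exact (mul_le_mul_of_nonneg_left h1.le (abs_nonneg _)).trans h3
    · refine le_trans ?_ (Nat.cast_le.2 (le_max_right _ _))
      have hstep : ∀ k, ((T^[k + 1] v).1 : ℝ)
          = (T^[k] v).1 - Metric.infDist (T^[k] v).1 S / 2 := fun k => by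
        rw [Function.iterate_succ_apply', TM _ (hTM v h h' k).1 (hTM v h h' k).2]
        exact M3 _
      refine encard_le_of_potential (Φ := fun k => -((T^[k] v).1 : ℝ)) ?_ (half_pos hη) ?_ ?_
      · refine monotone_nat_of_le_succ fun k => ?_
        have := Metric.infDist_nonneg (x := (T^[k] v).1) (s := S)
        rw [hstep]; linarith
      · intro k hk
        have hd : η ≤ Metric.infDist (T^[k] v).1 S := by
          rw [Metric.le_infDist ⟨l, Or.inl (Or.inr hlP)⟩]
          obtain ⟨ha, hb⟩ := hTM v h h' k
          intro y hy
          rw [Subtype.dist_eq, Real.dist_eq]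
          rcases hy with (hy | hy) | hy
          · have h1 := (hk l hlP).le
            have h2 : (l : ℝ) ≤ (T^[k] v).1 := ha
            have h3 : (y : ℝ) ≤ l := hy
            rw [abs_of_nonneg (sub_nonneg.2 h2)] at h1
            rw [abs_of_nonneg (by linarith)]
            linarith
          · exact (hk y hy).le
          · have h1 := (hk u huP).le
            have h2 : ((T^[k] v).1 : ℝ) ≤ u := hb
            have h3 : (u : ℝ) ≤ y := hy
            rw [abs_sub_comm, abs_of_nonneg (sub_nonneg.2 h2)] at h1
            rw [abs_sub_comm, abs_of_nonneg (by linarith)]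
            linarith
        simp only [hstep]
        linarith
      · intro k _
        rw [abs_neg, abs_of_nonneg (T^[k] v).1.2.1]
        exact (T^[k] v).1.2.2

theorem exists_coordinates_of_mem_uniformity {V : Set ((ℕ → Icc (0:ℝ) 1) × (ℕ → Icc (0:ℝ) 1))}
    (hV : V ∈ uniformity (ℕ → Icc (0:ℝ) 1)) :
    ∃ m r : ℕ, 0 < r ∧ ∀ x y : ℕ → Icc (0:ℝ) 1,
      (∀ i < m, |(x i : ℝ) - y i| ≤ 2 / r) → (x, y) ∈ V := by
  rw [Pi.uniformity, Filter.mem_iInf] at hV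
  obtain ⟨I, hI, W, hW, rfl⟩ := hV
  have h1 : ∀ i : I, ∃ r : ℕ, 0 < r ∧ ∀ x y : ℕ → Icc (0:ℝ) 1,
      |(x i : ℝ) - y i| < 2 / r → (x, y) ∈ W i := by
    intro i
    obtain ⟨t, ht, hts⟩ := hW i
    obtain ⟨ε, hε, hεt⟩ := Metric.mem_uniformity_dist.1 ht
    obtain ⟨r, hr⟩ := exists_nat_gt (2 / ε)
    have hr0 : (0:ℝ) < r := lt_trans (by positivity) hr
    refine ⟨r, by exact_mod_cast hr0, fun x y hxy => hts (hεt ?_)⟩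
    rw [Subtype.dist_eq, Real.dist_eq]
    refine hxy.trans ?_
    rw [div_lt_iff₀ hr0]
    rwa [div_lt_iff₀ hε, mul_comm] at hr
  choose r hr0 hr using h1
  have := hI.fintype
  obtain ⟨m, hm⟩ := hI.bddAbove
  refine ⟨m + 1, Finset.univ.sup r + 1, by omega, fun x y hxy => ?_⟩
  refine mem_iInter.2 fun i => hr i x y ?_
  refine (hxy i (Nat.lt_succ_of_le (hm i.2))).trans_lt ?_
  have h2 : r i ≤ Finset.univ.sup r := Finset.le_sup (Finset.mem_univ i)
  have h3 : (0:ℝ) < r i := by exact_mod_cast hr0 i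
  gcongr
  exact_mod_cast Nat.lt_succ_of_le h2

/-- The self-map of the Hilbert cube acting by `T n` on the pair of coordinates `(n, n + M)`,
for every `n < M`. -/
def pairwiseMap (M : ℕ) (T : ℕ → Icc (0:ℝ) 1 × Icc (0:ℝ) 1 → Icc (0:ℝ) 1 × Icc (0:ℝ) 1)
    (x : ℕ → Icc (0:ℝ) 1) : ℕ → Icc (0:ℝ) 1 := fun n =>
  if n < M then (T n (x n, x (n + M))).1
  else if n < M + M then (T (n - M) (x (n - M), x n)).2 else x n

theorem pairwiseMap_pair (M : ℕ)
    (T : ℕ → Icc (0:ℝ) 1 × Icc (0:ℝ) 1 → Icc (0:ℝ) 1 × Icc (0:ℝ) 1)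
    (x : ℕ → Icc (0:ℝ) 1) {n : ℕ} (hn : n < M) :
    (pairwiseMap M T x n, pairwiseMap M T x (n + M)) = T n (x n, x (n + M)) := by
  simp [pairwiseMap, hn]

theorem pairwiseMap_leftInverse (M : ℕ)
    {T S : ℕ → Icc (0:ℝ) 1 × Icc (0:ℝ) 1 → Icc (0:ℝ) 1 × Icc (0:ℝ) 1}
    (h : ∀ n v, S n (T n v) = v) (x : ℕ → Icc (0:ℝ) 1) :
    pairwiseMap M S (pairwiseMap M T x) = x := by
  funext n
  rcases lt_or_ge n M with hn | hn
  · have := pairwiseMap_pair M S (pairwiseMap M T x) hn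
    rw [pairwiseMap_pair M T x hn, h] at this
    exact congrArg Prod.fst this
  rcases lt_or_ge n (M + M) with hn' | hn'
  · obtain ⟨k, rfl⟩ := Nat.exists_eq_add_of_le' hn
    have hk : k < M := by omega
    have := pairwiseMap_pair M S (pairwiseMap M T x) hk
    rw [pairwiseMap_pair M T x hk, h] at this
    exact congrArg Prod.snd this
  · simp [pairwiseMap, hn.not_gt, hn'.not_gt]

theorem continuous_pairwiseMap (M : ℕ)
    {T : ℕ → Icc (0:ℝ) 1 × Icc (0:ℝ) 1 → Icc (0:ℝ) 1 × Icc (0:ℝ) 1}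
    (hT : ∀ n, Continuous (T n)) : Continuous (pairwiseMap M T) := by
  refine continuous_pi fun n => ?_
  unfold pairwiseMap
  have h1 := hT n
  have h2 := hT (n - M)
  split_ifs <;> fun_prop

/-- The homeomorphism of the Hilbert cube acting by `T n` on the pair of coordinates
`(n, n + M)`, for every `n < M`. -/
def pairwiseHomeomorph (M : ℕ)
    (T : ℕ → Icc (0:ℝ) 1 × Icc (0:ℝ) 1 ≃ₜ Icc (0:ℝ) 1 × Icc (0:ℝ) 1) :
    (ℕ → Icc (0:ℝ) 1) ≃ₜ (ℕ → Icc (0:ℝ) 1) where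
  toFun := pairwiseMap M fun n => T n
  invFun := pairwiseMap M fun n => (T n).symm
  left_inv := pairwiseMap_leftInverse M fun n v => (T n).symm_apply_apply v
  right_inv := pairwiseMap_leftInverse M fun n v => (T n).apply_symm_apply v
  continuous_toFun := continuous_pairwiseMap M fun n => (T n).continuous
  continuous_invFun := continuous_pairwiseMap M fun n => (T n).symm.continuous

theorem iterate_pairwiseHomeomorph_pair (M : ℕ)
    (T : ℕ → Icc (0:ℝ) 1 × Icc (0:ℝ) 1 ≃ₜ Icc (0:ℝ) 1 × Icc (0:ℝ) 1) (k : ℕ)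
    (x : ℕ → Icc (0:ℝ) 1) {n : ℕ} (hn : n < M) :
    ((pairwiseHomeomorph M T)^[k] x n, (pairwiseHomeomorph M T)^[k] x (n + M)) =
      (T n)^[k] (x n, x (n + M)) := by
  induction k with
  | zero => rfl
  | succ k ih =>
    rw [Function.iterate_succ_apply', Function.iterate_succ_apply', ← ih]
    exact pairwiseMap_pair M (fun n => T n) _ hn

theorem exists_homeomorph_iterate {X : Type*} [TopologicalSpace X] (h : X ≃ₜ X) (k : ℕ) :
    ∃ g : X ≃ₜ X, ∀ x, g x = h^[k] x := by
  induction k with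
  | zero => exact ⟨Homeomorph.refl X, fun x => rfl⟩
  | succ k ih =>
    obtain ⟨g, hg⟩ := ih
    exact ⟨g.trans h, fun x => by rw [Function.iterate_succ_apply', ← hg]; rfl⟩

theorem encard_biUnion_le_sum {ι α : Type*} (s : Finset ι) (B : ι → Set α) (C : ι → ℕ)
    (h : ∀ i ∈ s, (B i).encard ≤ C i) : (⋃ i ∈ s, B i).encard ≤ (∑ i ∈ s, C i : ℕ) := by
  classical
  induction s using Finset.induction_on with
  | empty => simp
  | insert a s ha ih =>
    rw [Finset.set_biUnion_insert, Finset.sum_insert ha, Nat.cast_add]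
    refine (encard_union_le _ _).trans (add_le_add (h a (by simp)) (ih fun i hi => h i ?_))
    simp [hi]

theorem dist_le_of_forall_le_iff {r : ℕ} (hr : 0 < r) {q : ℕ → ℝ}
    (hq : ∀ j < r, (j : ℝ) / r < q j ∧ q j < (j + 1) / r) {a b : ℝ} (ha : 0 ≤ a) (ha' : a ≤ 1)
    (hb : 0 ≤ b) (hb' : b ≤ 1) (h : ∀ j < r, (a ≤ q j → b ≤ q j) ∧ (q j ≤ a → q j ≤ b)) :
    |b - a| ≤ 2 / r := by
  have hr0 : (0:ℝ) < r := by exact_mod_cast hr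
  have key : ∀ c d : ℝ, 0 ≤ c → d ≤ 1 → c + 2 / r < d → ∃ j < r, c < q j ∧ q j < d := by
    intro c d hc hd hcd
    have h1 := Nat.le_ceil (c * r)
    have h2 := Nat.ceil_lt_add_one (mul_nonneg hc hr0.le)
    have h3 : ((⌈c * r⌉₊ : ℝ) + 1) / r < d := by
      refine lt_of_le_of_lt ?_ hcd
      rw [div_le_iff₀ hr0, add_mul, div_mul_cancel₀ _ hr0.ne']
      linarith
    have h4 : ⌈c * r⌉₊ < r := by
      have : (⌈c * r⌉₊ : ℝ) + 1 < r := by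
        have := h3.trans_le hd
        rwa [div_lt_one hr0] at this
      exact_mod_cast (by linarith : (⌈c * r⌉₊ : ℝ) < r)
    refine ⟨_, h4, lt_of_le_of_lt ?_ (hq _ h4).1, (hq _ h4).2.trans h3⟩
    rwa [le_div_iff₀ hr0]
  by_contra! hlt
  rcases lt_abs.1 hlt with hlt | hlt
  · obtain ⟨j, hj, h1, h2⟩ := key a b ha hb' (by linarith)
    exact absurd ((h j hj).1 h1.le) (not_le.2 h2)
  · obtain ⟨j, hj, h1, h2⟩ := key b a hb ha' (by linarith)
    exact absurd ((h j hj).2 h2.le) (not_le.2 h1)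

theorem exists_grid_mem_isOpen {U : Set (ℕ → Icc (0:ℝ) 1)} (hU : IsOpen U) (hUd : Dense U)
    (m r : ℕ) :
    ∃ p : ℕ → ℕ → Icc (0:ℝ) 1, (∀ i j, 0 < (p i j : ℝ) ∧ (p i j : ℝ) < 1) ∧
      (∀ i < m, ∀ j < r, (j : ℝ) / r < p i j ∧ (p i j : ℝ) < (j + 1) / r) ∧
      ∀ J : Fin m → Fin r, (fun i => p i (if h : i < m then J ⟨i, h⟩ else 0)) ∈ U := by
  have hinterior : Dense {t : Icc (0:ℝ) 1 | 0 < (t : ℝ) ∧ (t : ℝ) < 1} := by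
    refine Metric.dense_iff.2 fun x ε hε => ?_
    obtain ⟨x, hx0, hx1⟩ := x
    set t := min 1 ε with ht
    have ht0 : 0 < t := lt_min one_pos hε
    have ht1 : t ≤ 1 := min_le_left _ _
    have htε : t ≤ ε := min_le_right _ _
    refine ⟨⟨x + t * (1 / 2 - x), by nlinarith, by nlinarith⟩, ?_, ?_, ?_⟩
    · rw [Metric.mem_ball, Subtype.dist_eq, Real.dist_eq, abs_lt]
      constructor <;> nlinarith
    · change 0 < x + t * (1 / 2 - x)
      nlinarith
    · change x + t * (1 / 2 - x) < 1
      nlinarith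
  have hD : Dense {p : ℕ → ℕ → Icc (0:ℝ) 1 | ∀ i j, 0 < (p i j : ℝ) ∧ (p i j : ℝ) < 1} := by
    have h1 : Dense (univ.pi fun _ : ℕ => {t : Icc (0:ℝ) 1 | 0 < (t : ℝ) ∧ (t : ℝ) < 1}) :=
      dense_pi univ fun j _ => hinterior
    have h2 : Dense (univ.pi fun _ : ℕ => univ.pi fun _ : ℕ =>
        {t : Icc (0:ℝ) 1 | 0 < (t : ℝ) ∧ (t : ℝ) < 1}) := dense_pi univ fun _ _ => h1
    refine Dense.mono (fun p hp => ?_) h2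
    exact fun i j => hp i trivial j trivial
  set E : (Fin m → Fin r) → Set (ℕ → ℕ → Icc (0:ℝ) 1) := fun J =>
    {p | (fun i => p i (if h : i < m then J ⟨i, h⟩ else 0)) ∈ U} with hE
  have hEo : ∀ J, IsOpen (E J) := fun J => hU.preimage (by fun_prop)
  have hEd : ∀ J, Dense (E J) := by
    intro J
    refine hUd.preimage (f := fun p : ℕ → ℕ → Icc (0:ℝ) 1 =>
      (fun i => p i (if h : i < m then J ⟨i, h⟩ else 0))) ?_
    exact IsOpenMap.piMap (fun i => isOpenMap_eval _)
      (Filter.Eventually.of_forall fun i => Function.surjective_eval _)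
  have hEI : Dense (⋂ J, E J) := dense_iInter_of_isOpen hEo hEd
  set O : Set (ℕ → ℕ → Icc (0:ℝ) 1) := ⋂ i ∈ Finset.range m, ⋂ j ∈ Finset.range r,
    {p | (j : ℝ) / r < p i j ∧ (p i j : ℝ) < (j + 1) / r} with hO
  have hOo : IsOpen O := by
    refine isOpen_biInter_finset fun i _ => isOpen_biInter_finset fun j _ => ?_
    have hc : Continuous fun p : ℕ → ℕ → Icc (0:ℝ) 1 => (p i j : ℝ) := by fun_prop
    exact (isOpen_lt continuous_const hc).inter (isOpen_lt hc continuous_const)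
  have hOn : O.Nonempty := by
    refine ⟨fun i j => projIcc 0 1 zero_le_one ((j + 1 / 2) / r), ?_⟩
    simp only [hO, mem_iInter, Finset.mem_range, mem_ofPred_eq]
    intro i _ j hj
    have hr : (0:ℝ) < r := by exact_mod_cast (Nat.zero_le j).trans_lt hj
    have hj' : (j:ℝ) + 1 ≤ r := by exact_mod_cast hj
    have h1 : ((j:ℝ) + 1 / 2) / r ≤ 1 := by rw [div_le_one hr]; linarith
    rw [projIcc_of_mem zero_le_one ⟨by positivity, h1⟩]
    constructor
    · exact div_lt_div_of_pos_right (by linarith) hr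
    · exact div_lt_div_of_pos_right (by linarith) hr
  obtain ⟨p, ⟨hpO, hpE⟩, hpD⟩ := hD.inter_open_nonempty _
    (hOo.inter (isOpen_iInter_of_finite hEo)) (hEI.inter_open_nonempty O hOo hOn)
  refine ⟨p, hpD, fun i hi j hj => ?_, fun J => mem_iInter.1 hpE J⟩
  simp only [hO, mem_iInter, Finset.mem_range, mem_ofPred_eq] at hpO
  exact hpO i hi j hj

theorem exists_homeomorph_seq_encard_le {U : Set (ℕ → Icc (0:ℝ) 1)} (hU : IsOpen U)
    (hUd : Dense U) {V : Set ((ℕ → Icc (0:ℝ) 1) × (ℕ → Icc (0:ℝ) 1))}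
    (hV : V ∈ uniformity (ℕ → Icc (0:ℝ) 1)) :
    ∃ (C : ℕ) (K : Set (ℕ → Icc (0:ℝ) 1)) (φ : ℕ → (ℕ → Icc (0:ℝ) 1) ≃ₜ (ℕ → Icc (0:ℝ) 1)),
      IsCompact K ∧ K ⊆ U ∧ (∀ k x, (φ k x, x) ∈ V) ∧
      ∀ x, {k | φ k x ∉ K}.encard ≤ C := by
  classical
  obtain ⟨m, r, hr, hmr⟩ := exists_coordinates_of_mem_uniformity hV
  obtain ⟨p, hp01, hpcell, hpU⟩ := exists_grid_mem_isOpen hU hUd m r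
  set π : (Fin m → Fin r) → ℕ → Icc (0:ℝ) 1 := fun J i =>
    p i (if h : i < m then J ⟨i, h⟩ else 0) with hπ
  have hW : ∃ W ∈ uniformity (ℕ → Icc (0:ℝ) 1), ∀ J, ∀ y, (π J, y) ∈ W → y ∈ U := by
    have h1 : ∀ J, ∃ W ∈ uniformity (ℕ → Icc (0:ℝ) 1), ∀ y, (π J, y) ∈ W → y ∈ U := fun J => by
      obtain ⟨W, hW, hWU⟩ := UniformSpace.mem_nhds_iff.1 (hU.mem_nhds (hpU J))
      exact ⟨W, hW, fun y hy => hWU hy⟩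
    choose W hW hWU using h1
    exact ⟨⋂ J, W J, Filter.iInter_mem.2 hW, fun J y hy => hWU J y (mem_iInter.1 hy J)⟩
  obtain ⟨W, hW, hWU⟩ := hW
  obtain ⟨M₀, R, hR, hM₀⟩ := exists_coordinates_of_mem_uniformity hW
  set M := max M₀ m with hM
  set η : ℝ := 2 / R with hη
  have hη0 : 0 < η := by have : (0:ℝ) < R := by exact_mod_cast hR
                         positivity
  set P : ℕ → Finset (Icc (0:ℝ) 1) := fun i => Finset.univ.image fun J => π J i with hP
  have hPn : ∀ i, (P i).Nonempty := fun i =>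
    Finset.Nonempty.image ⟨fun _ => ⟨0, hr⟩, Finset.mem_univ _⟩ _
  have hPp : ∀ i, ∀ q ∈ P i, 0 < (q : ℝ) ∧ (q : ℝ) < 1 := by
    intro i q hq
    obtain ⟨J, -, rfl⟩ := Finset.mem_image.1 hq
    exact hp01 _ _
  choose T C hT hC using fun i => exists_squarePush (hPn i) (hPp i) hη0
  choose φ hφ using exists_homeomorph_iterate (pairwiseHomeomorph M T)
  have hφpair : ∀ k x, ∀ n < M, φ k x n = ((T n)^[k] (x n, x (n + M))).1 := by
    intro k x n hn
    rw [hφ, ← iterate_pairwiseHomeomorph_pair M T k x hn]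
  have hTk : ∀ i, ∀ q ∈ P i, ∀ k v, (v.1 ≤ q → ((T i)^[k] v).1 ≤ q) ∧
      (q ≤ v.1 → q ≤ ((T i)^[k] v).1) := by
    intro i q hq k v
    induction k with
    | zero => exact ⟨id, id⟩
    | succ k ih =>
      rw [Function.iterate_succ_apply']
      exact ⟨fun h => (hT i q hq _).1 (ih.1 h), fun h => (hT i q hq _).2 (ih.2 h)⟩
  refine ⟨∑ i ∈ Finset.range M, C i, ⋃ J, {x | ∀ i < M, |(π J i : ℝ) - x i| ≤ η}, φ,
    ?_, ?_, fun k x => hmr _ _ fun i hi => ?_, fun x => ?_⟩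
  · refine IsClosed.isCompact (isClosed_iUnion_of_finite fun J => ?_)
    simp only [ofPred_forall]
    exact isClosed_iInter fun i => isClosed_iInter fun _ =>
      isClosed_le (by fun_prop) (by fun_prop)
  · refine iUnion_subset fun J x hx => hWU J x (hM₀ _ _ fun i hi => ?_)
    exact hx i (hi.trans_le (le_max_left _ _))
  · rw [hφpair k x i (hi.trans_le (le_max_right _ _))]
    refine dist_le_of_forall_le_iff hr (q := fun j => p i j) (hpcell i hi) (x i).2.1 (x i).2.2
      ((T i)^[k] (x i, x (i + M))).1.2.1 ((T i)^[k] (x i, x (i + M))).1.2.2 fun j hj => ?_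
    have hmem : p i j ∈ P i := Finset.mem_image.2
      ⟨fun _ => ⟨j, hj⟩, Finset.mem_univ _, by simp [hπ, hi]⟩
    exact hTk i _ hmem k (x i, x (i + M))
  · refine (encard_le_encard ?_).trans (encard_biUnion_le_sum (Finset.range M)
      (fun i => {k | ∀ q ∈ P i, η < |(((T i)^[k] (x i, x (i + M))).1 : ℝ) - q|}) C
      fun i _ => hC i _)
    intro k hk
    by_contra hcon
    simp only [Finset.mem_range, mem_iUnion, mem_ofPred_eq, not_exists, not_forall, not_lt] at hcon
    apply hk
    have h1 : ∀ i : Fin m, ∃ j : Fin r, |(p i j : ℝ) - φ k x i| ≤ η := by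
      intro i
      obtain ⟨q, hq, hle⟩ := hcon i (i.2.trans_le (le_max_right _ _))
      obtain ⟨J, -, rfl⟩ := Finset.mem_image.1 hq
      refine ⟨J i, ?_⟩
      rw [hφpair k x i (i.2.trans_le (le_max_right _ _)), abs_sub_comm]
      simpa [hπ] using hle
    choose J hJ using h1
    refine mem_iUnion.2 ⟨J, fun i hi => ?_⟩
    by_cases him : i < m
    · simpa [hπ, him] using hJ ⟨i, him⟩
    · obtain ⟨q, hq, hle⟩ := hcon i hi
      obtain ⟨J', -, rfl⟩ := Finset.mem_image.1 hq
      rw [hφpair k x i hi, abs_sub_comm]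
      simpa [hπ, him] using hle

theorem exists_homeomorph_limit {X : Type*} [MetricSpace X] [CompactSpace X] (g : ℕ → X ≃ₜ X)
    {ε : ℕ → ℝ} (hε : ∀ n, 0 < ε n) (hhalf : ∀ n, ε (n + 1) ≤ ε n / 2)
    (hstep : ∀ n x, dist (g (n + 1) x) (g n x) ≤ ε n)
    (hmod : ∀ n x y, dist (g (n + 1) x) (g (n + 1) y) ≤ 4 * ε (n + 1) →
      dist x y ≤ 1 / ((n : ℝ) + 1)) :
    ∃ h : X ≃ₜ X, ∀ n x, dist (g n x) (h x) ≤ 2 * ε n := by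
  have hbound : ∀ k n x, dist (g n x) (g (n + k) x) ≤ 2 * ε n := by
    intro k
    induction k with
    | zero => intro n x; simpa using (hε n).le
    | succ k ih =>
      intro n x
      have h1 := dist_triangle_left (g n x) (g (n + (k + 1)) x) (g (n + 1) x)
      have h2 := ih (n + 1) x
      rw [show n + 1 + k = n + (k + 1) by ring] at h2
      linarith [hstep n x, hhalf n]
  have hle : ∀ n, ε n ≤ ε 0 * (1 / 2) ^ n := by
    intro n
    induction n with
    | zero => simp
    | succ n ih => rw [pow_succ]; linarith [hhalf n]
  have hlim : Filter.Tendsto (fun n => 2 * ε n) Filter.atTop (𝓝 0) := by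
    have h1 : Filter.Tendsto (fun n : ℕ => 2 * (ε 0 * (1 / 2) ^ n)) Filter.atTop (𝓝 0) := by
      have := (tendsto_pow_atTop_nhds_zero_of_lt_one (r := (1 / 2 : ℝ)) (by norm_num)
        (by norm_num)).const_mul (ε 0) |>.const_mul 2
      simpa using this
    exact squeeze_zero (fun n => by linarith [hε n]) (fun n => by linarith [hle n]) h1
  have hcauchy : ∀ x, CauchySeq fun n => g n x := fun x => by
    refine cauchySeq_of_le_tendsto_0' (fun n => 2 * ε n) (fun n m hnm => ?_) hlim
    obtain ⟨k, rfl⟩ := Nat.exists_eq_add_of_le hnm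
    exact hbound k n x
  choose h hh using fun x => cauchySeq_tendsto_of_complete (hcauchy x)
  have hdist : ∀ n x, dist (g n x) (h x) ≤ 2 * ε n := by
    intro n x
    refine le_of_tendsto (tendsto_const_nhds.dist (hh x)) ?_
    filter_upwards [Filter.eventually_ge_atTop n] with m hm
    obtain ⟨k, rfl⟩ := Nat.exists_eq_add_of_le hm
    exact hbound k n x
  have hunif : TendstoUniformly (fun n => (g n : X → X)) h Filter.atTop := by
    refine Metric.tendstoUniformly_iff.2 fun δ hδ => ?_
    filter_upwards [hlim.eventually_lt_const hδ] with n hn x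
    rw [dist_comm]
    exact (hdist n x).trans_lt hn
  have hcont : Continuous h :=
    hunif.continuous (Filter.Frequently.of_forall fun n => (g n).continuous)
  have hinj : Function.Injective h := by
    intro x y hxy
    have h1 : ∀ n : ℕ, dist x y ≤ 1 / ((n : ℝ) + 1) := fun n => hmod n x y (by
      have h2 := hdist (n + 1) x
      have h3 := hdist (n + 1) y
      have h4 := dist_triangle_right (g (n + 1) x) (g (n + 1) y) (h x)
      rw [← hxy] at h3
      linarith)
    exact dist_le_zero.1 (ge_of_tendsto' tendsto_one_div_add_atTop_nhds_zero_nat h1)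
  have hsurj : Function.Surjective h := by
    intro y
    have hcl : IsClosed (range h) := (isCompact_range hcont).isClosed
    have h1 : y ∈ closure (range h) := by
      refine mem_closure_of_tendsto (f := fun n => h ((g n).symm y)) (b := Filter.atTop) ?_
        (Filter.Eventually.of_forall fun n => mem_range_self _)
      refine tendsto_iff_dist_tendsto_zero.2
        (squeeze_zero (fun n => dist_nonneg) (fun n => ?_) hlim)
      have := hdist n ((g n).symm y)
      rwa [(g n).apply_symm_apply, dist_comm] at this
    rwa [hcl.closure_eq] at h1
  exact ⟨(isHomeomorph_iff_continuous_bijective.2 ⟨hcont, hinj, hsurj⟩).homeomorph h, hdist⟩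

theorem exists_refining_homeomorph_seq {X : Type*} [MetricSpace X] [CompactSpace X] {U : Set X}
    (hU : IsOpen U) {ε : ℝ} (hε : 0 < ε) (h : X ≃ₜ X)
    (hS : ∃ (C : ℕ) (K : Set X) (φ : ℕ → X ≃ₜ X), IsCompact K ∧ K ⊆ U ∧
      (∀ k x, dist (φ k x) x < ε) ∧ ∀ x, {k | φ k x ∉ K}.encard ≤ C) {δ : ℝ} (hδ : 0 < δ) :
    ∃ (C : ℕ) (g : ℕ → X ≃ₜ X) (ε' : ℕ → ℝ),
      (∀ k, 0 < ε' k) ∧ (∀ k, ε' k ≤ ε / 2) ∧ (∀ k x, dist (g k x) (h x) ≤ ε) ∧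
      (∀ k x y, dist (g k x) (g k y) ≤ 4 * ε' k → dist x y ≤ δ) ∧
      ∀ x, {k | ¬ ∀ y, dist (g k x) y ≤ 2 * ε' k → y ∈ U}.encard ≤ C := by
  obtain ⟨C, K, φ, hK, hKU, hφ, hC⟩ := hS
  obtain ⟨ρ, hρ, hρU⟩ := hK.exists_cthickening_subset_open hU hKU
  have hmod : ∀ k, ∃ θ > 0, ∀ x y, dist (φ k (h x)) (φ k (h y)) < θ → dist x y < δ := by
    intro k
    have hu : UniformContinuous (h.trans (φ k)).symm :=
      CompactSpace.uniformContinuous_of_continuous (h.trans (φ k)).symm.continuous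
    obtain ⟨θ, hθ, hθ'⟩ := Metric.uniformContinuous_iff.1 hu δ hδ
    refine ⟨θ, hθ, fun x y hxy => ?_⟩
    have := hθ' (a := (h.trans (φ k)) x) (b := (h.trans (φ k)) y) hxy
    simpa only [Homeomorph.symm_apply_apply] using this
  choose θ hθ hθ' using hmod
  refine ⟨C, fun k => h.trans (φ k), fun k => min (ε / 2) (min (ρ / 2) (θ k / 8)), fun k => ?_,
    fun k => min_le_left _ _, fun k x => (hφ k (h x)).le, fun k x y hxy => ?_, fun x => ?_⟩
  · have := hθ k
    positivity
  · refine (hθ' k x y (hxy.trans_lt ?_)).le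
    have h1 : min (ε / 2) (min (ρ / 2) (θ k / 8)) ≤ θ k / 8 :=
      (min_le_right _ _).trans (min_le_right _ _)
    linarith [hθ k]
  · refine le_trans (encard_le_encard fun k hk => ?_) (hC (h x))
    intro hkK
    refine hk fun y hy => hρU ?_
    refine Metric.mem_cthickening_of_dist_le y _ ρ K hkK ?_
    have h1 : min (ε / 2) (min (ρ / 2) (θ k / 8)) ≤ ρ / 2 :=
      (min_le_right _ _).trans (min_le_left _ _)
    rw [dist_comm]
    refine hy.trans ?_
    linarith

/-- The list of the first `n` values of `f`, most recent first. -/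
def initialSegment (f : ℕ → ℕ) : ℕ → List ℕ
  | 0 => []
  | n + 1 => f n :: initialSegment f n

theorem length_initialSegment (f : ℕ → ℕ) (n : ℕ) : (initialSegment f n).length = n := by
  induction n with
  | zero => rfl
  | succ n ih => simp [initialSegment, ih]

theorem exists_homeomorph_tree {X : Type*} [MetricSpace X] [CompactSpace X]
    (hS : ∀ U : Set X, IsOpen U → Dense U → ∀ ε > 0,
      ∃ (C : ℕ) (K : Set X) (φ : ℕ → X ≃ₜ X), IsCompact K ∧ K ⊆ U ∧
        (∀ k x, dist (φ k x) x < ε) ∧ ∀ x, {k | φ k x ∉ K}.encard ≤ C)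
    {A : Set X} (hA : IsGδ A) (hAd : Dense A) :
    ∃ (C : List ℕ → ℕ) (h : (ℕ → ℕ) → X ≃ₜ X) (b : X → List ℕ → Finset ℕ),
      (∀ x s, (b x s).card ≤ C s) ∧
      ∀ f x, (∃ᶠ n in Filter.atTop, f n ∉ b x (initialSegment f n)) → h f x ∈ A := by
  classical
  obtain ⟨U, hUo, rfl⟩ := hA.eq_iInter_nat
  set W : ℕ → Set X := fun n => ⋂ i ∈ Finset.range (n + 1), U i with hW
  have hWo : ∀ n, IsOpen (W n) := fun n => isOpen_biInter_finset fun i _ => hUo i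
  have hWd : ∀ n, Dense (W n) := fun n =>
    hAd.mono (subset_iInter₂ fun i _ => iInter_subset _ i)
  have hWU : ∀ i n, i ≤ n → W n ⊆ U i := fun i n hin =>
    biInter_subset_of_mem (Finset.mem_coe.2 (Finset.mem_range.2 (Nat.lt_succ_of_le hin)))
  choose C g ε hε0 hε2 hstep hmod hbad using fun (n : ℕ) (s : (X ≃ₜ X) × {ε : ℝ // 0 < ε}) =>
    exists_refining_homeomorph_seq (hWo n) s.2.2 s.1 (hS _ (hWo n) (hWd n) _ s.2.2)
      (δ := 1 / ((n : ℝ) + 1)) (by positivity)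
  set st : List ℕ → (X ≃ₜ X) × {ε : ℝ // 0 < ε} := fun s =>
    List.rec (Homeomorph.refl X, ⟨1, one_pos⟩)
      (fun k t r => (g t.length r k, ⟨ε t.length r k, hε0 _ _ _⟩)) s with hst
  have hst' : ∀ k t, st (k :: t) = (g t.length (st t) k, ⟨ε t.length (st t) k, hε0 _ _ _⟩) :=
    fun k t => rfl
  have hfin : ∀ x s, {k | ¬ ∀ y, dist (g s.length (st s) k x) y ≤
      2 * ε s.length (st s) k → y ∈ W s.length}.Finite := fun x s =>
    finite_of_encard_le_coe (hbad s.length (st s) x)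
  have hstep' : ∀ (f : ℕ → ℕ) n, st (initialSegment f (n + 1)) =
      (g n (st (initialSegment f n)) (f n),
        ⟨ε n (st (initialSegment f n)) (f n), hε0 _ _ _⟩) := by
    intro f n
    have := hst' (f n) (initialSegment f n)
    simp only [length_initialSegment] at this
    exact this
  have hlim : ∀ f : ℕ → ℕ, ∃ h : X ≃ₜ X, ∀ n x,
      dist ((st (initialSegment f n)).1 x) (h x) ≤ 2 * (st (initialSegment f n)).2.1 := by
    intro f
    refine exists_homeomorph_limit (fun n => (st (initialSegment f n)).1)
      (fun n => (st (initialSegment f n)).2.2) (fun n => ?_) (fun n x => ?_) (fun n x y => ?_)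
    · rw [hstep']
      exact hε2 n _ _
    · rw [hstep']
      exact hstep n _ _ x
    · rw [hstep']
      exact hmod n _ _ x y
  choose h hh using hlim
  refine ⟨fun s => C s.length (st s), h, fun x s => (hfin x s).toFinset, fun x s => ?_,
    fun f x hf => mem_iInter.2 fun i => ?_⟩
  · have := hbad s.length (st s) x
    rw [(hfin x s).encard_eq_coe_toFinset_card] at this
    exact_mod_cast this
  · obtain ⟨n, hn, hin⟩ := (hf.and_eventually (Filter.eventually_ge_atTop i)).exists
    refine hWU i n hin ?_
    simp only [Finite.mem_toFinset, mem_ofPred_eq, not_not, length_initialSegment] at hn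
    refine hn _ ?_
    have := hh f (n + 1) x
    rwa [hstep'] at this

theorem exists_seq_isOpen_refining (X : Type*) [TopologicalSpace X] [SecondCountableTopology X]
    [Nonempty X] :
    ∃ U : ℕ → Set X, (∀ i, IsOpen (U i)) ∧ (∀ i, (U i).Nonempty) ∧
      ∀ O : Set X, IsOpen O → O.Nonempty → ∃ i, U i ⊆ O := by
  obtain ⟨b, hbc, hb0, hb⟩ := TopologicalSpace.exists_countable_basis X
  have hne : b.Nonempty := by
    obtain ⟨x⟩ := ‹Nonempty X›
    obtain ⟨t, ht, -⟩ := hb.exists_subset_of_mem_open (mem_univ x) isOpen_univ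
    exact ⟨t, ht⟩
  obtain ⟨U, rfl⟩ := hbc.exists_eq_range hne
  refine ⟨U, fun i => hb.isOpen (mem_range_self i), fun i => ?_, fun O hO hOn => ?_⟩
  · exact nonempty_iff_ne_empty.2 fun h => hb0 (h ▸ mem_range_self i)
  · obtain ⟨x, hx⟩ := hOn
    obtain ⟨_, ⟨i, rfl⟩, -, hi⟩ := hb.exists_subset_of_mem_open hx hO
    exact ⟨i, hi⟩

theorem IsMeagre.exists_antitone_isOpen_dense {X : Type*} [TopologicalSpace X] [BaireSpace X]
    {M : Set X} (hM : IsMeagre M) :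
    ∃ G : ℕ → Set X, Antitone G ∧ (∀ n, IsOpen (G n)) ∧ (∀ n, Dense (G n)) ∧
      ∀ x ∈ M, ∃ n, x ∉ G n := by
  obtain ⟨t, htM, ht, htd⟩ := mem_residual.1 hM
  obtain ⟨U, hU, rfl⟩ := ht.eq_iInter_nat
  refine ⟨fun n => ⋂ i ∈ Finset.range (n + 1), U i, fun m n hmn => ?_,
    fun n => isOpen_biInter_finset fun i _ => hU i,
    fun n => htd.mono (subset_iInter₂ fun i _ => iInter_subset _ i), fun x hx => ?_⟩
  · exact fun x hx => mem_iInter₂.2 fun i hi => mem_iInter₂.1 hx i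
      (Finset.mem_range.2 ((Finset.mem_range.1 hi).trans_le (Nat.succ_le_succ hmn)))
  · by_contra! hcon
    refine htM (mem_iInter.2 fun n => ?_) hx
    exact mem_iInter₂.1 (hcon n) n (Finset.self_mem_range_succ n)

theorem exists_bound_of_eventually_mem (φ : List ℕ → Finset ℕ) :
    ∃ g : ℕ → ℕ, ∀ f : ℕ → ℕ, (∀ᶠ n in Filter.atTop, f n ∈ φ (initialSegment f n)) →
      ∀ᶠ n in Filter.atTop, f n ≤ g n := by
  classical
  let L : List ℕ → ℕ → Finset (List ℕ) := fun s k =>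
    Nat.rec {s} (fun _ A => A.biUnion fun t => (φ t).image fun a => a :: t) k
  have hL : ∀ s k, L s (k + 1) = (L s k).biUnion fun t => (φ t).image fun a => a :: t :=
    fun s k => rfl
  refine ⟨fun n => (Finset.range (n + 1)).sup fun j =>
    ((L (Denumerable.ofNat (List ℕ) j) (n - (Denumerable.ofNat (List ℕ) j).length)).biUnion φ).sup
      id, fun f hf => ?_⟩
  obtain ⟨n₀, hn₀⟩ := Filter.eventually_atTop.1 hf
  set s := initialSegment f n₀ with hs
  have hmem : ∀ k, initialSegment f (n₀ + k) ∈ L s k := by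
    intro k
    induction k with
    | zero => exact Finset.mem_singleton_self _
    | succ k ih =>
      rw [hL]
      refine Finset.mem_biUnion.2 ⟨_, ih, Finset.mem_image.2 ⟨f (n₀ + k), ?_, rfl⟩⟩
      exact hn₀ _ (Nat.le_add_right _ _)
  filter_upwards [Filter.eventually_ge_atTop (max n₀ (Encodable.encode s))] with n hn
  obtain ⟨k, rfl⟩ := Nat.exists_eq_add_of_le ((le_max_left _ _).trans hn)
  have h1 : f (n₀ + k) ∈ (L s (n₀ + k - s.length)).biUnion φ := by
    rw [hs, length_initialSegment, Nat.add_sub_cancel_left]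
    exact Finset.mem_biUnion.2 ⟨_, hmem k, hn₀ _ (Nat.le_add_right _ _)⟩
  have h2 : Encodable.encode s ∈ Finset.range (n₀ + k + 1) :=
    Finset.mem_range.2 (Nat.lt_succ_of_le ((le_max_right _ _).trans hn))
  refine le_trans (Finset.le_sup (f := id) h1) ?_
  have h3 := Finset.le_sup (f := fun j => ((L (Denumerable.ofNat (List ℕ) j)
    (n₀ + k - (Denumerable.ofNat (List ℕ) j).length)).biUnion φ).sup id) h2
  simpa only [Denumerable.ofNat_encode] using h3

theorem exists_common_refinement {X : Type*} (U : ℕ → Set X) (b : ℕ → ℕ) (B : ℕ)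
    (Z : Finset (Finset ℕ))
    (hZ : ∀ z ∈ Z, ∀ d < Z.card, ∀ i ≤ b (B + d), ∃ i' ∈ z, i' ≤ b (B + d + 1) ∧ U i' ⊆ U i)
    {i : ℕ} (hi : i ≤ b B) :
    ∃ k ≤ b (B + Z.card), U k ⊆ U i ∧ ∀ z ∈ Z, ∃ i' ∈ z, U k ⊆ U i' := by
  classical
  induction Z using Finset.induction_on with
  | empty => exact ⟨i, hi, Subset.rfl, by simp⟩
  | insert z Z hz ih =>
    rw [Finset.card_insert_of_notMem hz] at hZ ⊢
    obtain ⟨k, hk, hki, hkZ⟩ := ih fun w hw d hd =>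
      hZ w (Finset.mem_insert_of_mem hw) d (hd.trans (Nat.lt_succ_self _))
    obtain ⟨l, hl, hlb, hlk⟩ :=
      hZ z (Finset.mem_insert_self _ _) Z.card (Nat.lt_succ_self _) k hk
    refine ⟨l, hlb, hlk.trans hki, fun w hw => ?_⟩
    rcases Finset.mem_insert.1 hw with rfl | hw
    · exact ⟨l, hl, Subset.rfl⟩
    · obtain ⟨i', hi', hki'⟩ := hkZ w hw
      exact ⟨i', hi', hlk.trans hki'⟩

theorem exists_dense_escape {X : Type*} [TopologicalSpace X] {U : ℕ → Set X}
    (hUo : ∀ i, IsOpen (U i)) (hUn : ∀ i, (U i).Nonempty)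
    (hUb : ∀ O : Set X, IsOpen O → O.Nonempty → ∃ i, U i ⊆ O) {b B : ℕ → ℕ}
    (hb : ∀ n, n ≤ b n) (hB : ∀ n, n ≤ B n) (Z : ℕ → Finset (Finset ℕ)) (D : ℕ → ℕ)
    (hZD : ∀ n, (Z n).card ≤ D n) :
    ∃ V : ℕ → Set X, (⋂ N, ⋃ n ≥ N, V n) ∈ residual X ∧
      ∀ n, ∀ z ∈ Z n, (∀ d < D n, ∀ i ≤ b (B n + d), ∃ i' ∈ z, i' ≤ b (B n + d + 1) ∧ U i' ⊆ U i) →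
        V n ⊆ ⋃ i ∈ z, U i := by
  classical
  set good : ℕ → Finset ℕ → Prop := fun n z =>
    ∀ d < D n, ∀ i ≤ b (B n + d), ∃ i' ∈ z, i' ≤ b (B n + d + 1) ∧ U i' ⊆ U i with hgood
  set V : ℕ → Set X := fun n =>
    ⋃ k ∈ {k : ℕ | ∀ z ∈ Z n, good n z → ∃ i' ∈ z, U k ⊆ U i'}, U k with hV
  refine ⟨V, ?_, fun n z hz hzg => iUnion₂_subset fun k hk => ?_⟩
  · refine countable_iInter_mem.2 fun N => residual_of_dense_open ?_ ?_
    · exact isOpen_biUnion fun n _ => isOpen_biUnion fun k _ => hUo k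
    · refine dense_iff_inter_open.2 fun O hO hOn => ?_
      obtain ⟨i, hi⟩ := hUb O hO hOn
      have hin : i ≤ b (B (max N i)) :=
        ((le_max_right N i).trans (hB _)).trans (hb _)
      have hcard : ((Z (max N i)).filter (good (max N i))).card ≤ D (max N i) :=
        (Finset.card_filter_le _ _).trans (hZD _)
      obtain ⟨k, -, hki, hkZ⟩ := exists_common_refinement U b (B (max N i))
        ((Z (max N i)).filter (good (max N i)))
        (fun z hz d hd => (Finset.mem_filter.1 hz).2 d (hd.trans_le hcard)) hin
      obtain ⟨x, hx⟩ := hUn k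
      refine ⟨x, hi (hki hx), mem_iUnion₂.2 ⟨max N i, le_max_left _ _, mem_iUnion₂.2 ⟨k, ?_, hx⟩⟩⟩
      exact fun z hz hg => hkZ z (Finset.mem_filter.2 ⟨hz, hg⟩)
  · obtain ⟨i', hi', hki'⟩ := hk z hz hzg
    exact hki'.trans (subset_biUnion_of_mem (u := U) (Finset.mem_coe.2 hi'))

theorem exists_escaping_family {X : Type*} [TopologicalSpace X] [SecondCountableTopology X]
    [BaireSpace X] {𝓜 : Set (Set X)} (hM : ∀ M ∈ 𝓜, IsMeagre M) (hunion : ¬ IsMeagre (⋃₀ 𝓜))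
    (C : List ℕ → ℕ) :
    ∃ f : 𝓜 → ℕ → ℕ, ∀ φ : List ℕ → Finset ℕ, (∀ s, (φ s).card ≤ C s) →
      ∃ M, ∃ᶠ n in Filter.atTop, f M n ∉ φ (initialSegment (f M) n) := by
  classical
  have hX : Nonempty X := by
    by_contra hX
    rw [not_nonempty_iff] at hX
    exact hunion (by rw [eq_empty_of_isEmpty (⋃₀ 𝓜)]; exact IsMeagre.empty)
  obtain ⟨U, hUo, hUn, hUb⟩ := exists_seq_isOpen_refining X
  choose G hGanti hGo hGd hG using fun M : 𝓜 => (hM M M.2).exists_antitone_isOpen_dense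
  have he : ∀ (M : 𝓜) (n : ℕ), ∃ e : ℕ, ∀ i ≤ n, ∃ i' ≤ e, U i' ⊆ U i ∧ U i' ⊆ G M n := by
    intro M n
    have h1 : ∀ i, ∃ i', U i' ⊆ U i ∩ G M n := fun i =>
      hUb _ ((hUo i).inter (hGo M n)) ((hGd M n).inter_open_nonempty _ (hUo i) (hUn i))
    choose j hj using h1
    exact ⟨(Finset.range (n + 1)).sup j, fun i hi => ⟨j i,
      Finset.le_sup (Finset.mem_range.2 (Nat.lt_succ_of_le hi)),
      (hj i).trans inter_subset_left, (hj i).trans inter_subset_right⟩⟩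
  choose e he using he
  by_cases hdom : ∃ g : ℕ → ℕ, ∀ M, ∀ᶠ n in Filter.atTop, e M n ≤ g n
  swap
  · refine ⟨e, fun φ _ => ?_⟩
    by_contra! hcon
    obtain ⟨g, hg⟩ := exists_bound_of_eventually_mem φ
    exact hdom ⟨g, fun M => hg _ (hcon M)⟩
  obtain ⟨g, hg⟩ := hdom
  let b : ℕ → ℕ := fun j => Nat.rec 0 (fun _ a => max (a + 1) (g a)) j
  have hb_succ : ∀ j, b (j + 1) = max (b j + 1) (g (b j)) := fun j => rfl
  have hb_mono : StrictMono b := strictMono_nat_of_lt_succ fun j => by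
    rw [hb_succ]; exact lt_max_of_lt_left (Nat.lt_succ_self _)
  clear_value b
  let st : ℕ → ℕ × Finset (List ℕ) := fun n => Nat.rec (0, {[]}) (fun _ p =>
    (p.1 + (∑ s ∈ p.2, C s) + 1, p.2.biUnion fun s =>
      (Finset.range (b (p.1 + (∑ s ∈ p.2, C s) + 1) + 1)).powerset.image fun z =>
        Denumerable.eqv (Finset ℕ) z :: s)) n
  set B : ℕ → ℕ := fun n => (st n).1 with hB
  set D : ℕ → ℕ := fun n => ∑ s ∈ (st n).2, C s with hD
  have hB_succ : ∀ n, B (n + 1) = B n + D n + 1 := fun n => rfl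
  have hS_succ : ∀ n, (st (n + 1)).2 = (st n).2.biUnion fun s =>
      (Finset.range (b (B (n + 1)) + 1)).powerset.image fun z =>
        Denumerable.eqv (Finset ℕ) z :: s :=
    fun n => rfl
  have hB_mono : StrictMono B := strictMono_nat_of_lt_succ fun n => by rw [hB_succ]; omega
  set z : 𝓜 → ℕ → Finset ℕ := fun M n =>
    (Finset.range (b (B (n + 1)) + 1)).filter fun i => U i ⊆ G M n with hz
  have hseg : ∀ M n, initialSegment (fun n => Denumerable.eqv (Finset ℕ) (z M n)) n ∈ (st n).2 := by
    intro M n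
    induction n with
    | zero => exact Finset.mem_singleton_self _
    | succ n ih =>
      rw [hS_succ]
      exact Finset.mem_biUnion.2 ⟨_, ih, Finset.mem_image.2
        ⟨z M n, Finset.mem_powerset.2 (Finset.filter_subset _ _), rfl⟩⟩
  refine ⟨fun M n => Denumerable.eqv (Finset ℕ) (z M n), fun φ hφ => ?_⟩
  by_contra! hcon
  obtain ⟨V, hVres, hV⟩ := exists_dense_escape hUo hUn hUb (fun n => hb_mono.le_apply)
    (fun n => hB_mono.le_apply)
    (fun n => (st n).2.biUnion fun s => (φ s).image (Denumerable.eqv (Finset ℕ)).symm) D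
    (fun n => Finset.card_biUnion_le.trans (Finset.sum_le_sum fun s _ =>
      Finset.card_image_le.trans (hφ s)))
  refine hunion (Filter.mem_of_superset hVres ?_)
  rintro x hx ⟨M, hM𝓜, hxM⟩
  obtain ⟨n₁, hn₁⟩ := hG ⟨M, hM𝓜⟩ x hxM
  obtain ⟨n₂, hn₂⟩ := Filter.eventually_atTop.1 (hg ⟨M, hM𝓜⟩)
  obtain ⟨n₃, hn₃⟩ := Filter.eventually_atTop.1 (hcon ⟨M, hM𝓜⟩)
  obtain ⟨n, hn, hxn⟩ := mem_iUnion₂.1 (mem_iInter.1 hx (max n₁ (max n₂ n₃)))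
  simp only [ge_iff_le, max_le_iff] at hn
  obtain ⟨hn1, hn2, hn3⟩ := hn
  have hmem : z ⟨M, hM𝓜⟩ n ∈ (st n).2.biUnion fun s =>
      (φ s).image (Denumerable.eqv (Finset ℕ)).symm :=
    Finset.mem_biUnion.2 ⟨_, hseg _ n, Finset.mem_image.2
      ⟨_, hn₃ n hn3, Equiv.symm_apply_apply _ _⟩⟩
  have hsub := hV n _ hmem fun d hd i hi => by
    have hle : n ≤ b (B n + d) :=
      (hB_mono.le_apply.trans (Nat.le_add_right _ _)).trans hb_mono.le_apply
    obtain ⟨i', hi', hi'U, hi'G⟩ := he ⟨M, hM𝓜⟩ (b (B n + d)) i hi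
    have h1 : i' ≤ b (B n + d + 1) := by
      rw [hb_succ]
      exact (hi'.trans (hn₂ _ (hn2.trans hle))).trans (le_max_right _ _)
    have h2 : b (B n + d + 1) ≤ b (B (n + 1)) := by
      refine hb_mono.monotone ?_
      rw [hB_succ]
      omega
    exact ⟨i', Finset.mem_filter.2 ⟨Finset.mem_range.2 (Nat.lt_succ_of_le (h1.trans h2)),
      hi'G.trans (hGanti _ hle)⟩, h1, hi'U⟩
  obtain ⟨i, hi, hxi⟩ := mem_iUnion₂.1 (hsub hxn)
  exact hn₁ (hGanti ⟨M, hM𝓜⟩ hn1 ((Finset.mem_filter.1 hi).2 hxi))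

theorem covIdeal_le_mk {X : Type*} {I 𝓐 : Set (Set X)} (h𝓐 : 𝓐 ⊆ I) (hcover : ⋃₀ 𝓐 = Set.univ) :
    covIdeal I ≤ #𝓐 :=
  csInf_le' ⟨𝓐, h𝓐, hcover, rfl⟩

theorem IsMinimalDenseGdelta.image {A : Set HilbertCube} (hA : IsMinimalDenseGdelta A)
    (h : HilbertCube ≃ₜ HilbertCube) : IsMinimalDenseGdelta (h '' A) := by
  obtain ⟨hG, hd, hmin⟩ := hA
  refine ⟨?_, h.surjective.denseRange.dense_image h.continuous hd, fun B hB hBd => ?_⟩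
  · rw [h.image_eq_preimage_symm]
    exact hG.preimage h.symm.continuous
  · obtain ⟨g, hg⟩ := hmin B hB hBd
    refine ⟨h.symm.trans g, ?_⟩
    rintro _ ⟨_, ⟨x, hx, rfl⟩, rfl⟩
    simpa using hg (mem_image_of_mem g hx)

theorem mem_sigmaG0_of_isMinimalDenseGdelta {A : Set HilbertCube}
    (hA : IsMinimalDenseGdelta A) : A ∈ sigmaG0 :=
  ⟨fun _ => A, fun _ => hA, fun _ hx => mem_iUnion.2 ⟨0, hx⟩⟩

theorem not_isMeagre_sUnion_meagerIdeal : ⋃₀ MeagerIdeal HilbertCube ∉ MeagerIdeal HilbertCube := by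
  have huniv : ⋃₀ MeagerIdeal HilbertCube = Set.univ := by
    refine eq_univ_of_forall fun x => ⟨{x}, ?_, rfl⟩
    exact residual_of_dense_open isOpen_compl_singleton (dense_compl_singleton x)
  rw [huniv]
  intro h
  have h1 : (Set.univ : Set HilbertCube)ᶜ ∈ residual HilbertCube := h
  have h2 := dense_of_mem_residual h1
  rw [compl_univ] at h2
  exact Set.not_nonempty_empty h2.nonempty

theorem exists_homeomorph_family {𝓜 : Set (Set HilbertCube)} (hM : ∀ M ∈ 𝓜, IsMeagre M)
    (hunion : ¬ IsMeagre (⋃₀ 𝓜)) {A : Set HilbertCube} (hA : IsGδ A) (hAd : Dense A) :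
    ∃ h : 𝓜 → HilbertCube ≃ₜ HilbertCube, ∀ x, ∃ M, h M x ∈ A := by
  let : MetricSpace HilbertCube := PiCountable.metricSpace
  obtain ⟨C, h, b, hb, hbA⟩ := exists_homeomorph_tree (X := HilbertCube)
    (fun U hU hUd ε hε => exists_homeomorph_seq_encard_le hU hUd (Metric.dist_mem_uniformity hε))
    hA hAd
  obtain ⟨f, hf⟩ := exists_escaping_family hM hunion C
  refine ⟨fun M => h (f M), fun x => ?_⟩
  obtain ⟨M, hM⟩ := hf (b x) (hb x)
  exact ⟨M, hbA _ _ hM⟩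

/-- `cov(σG₀) ≤ add(M)`. -/
theorem cov_sigmaG0_le_add_meager :
    covIdeal sigmaG0 ≤ addIdeal (MeagerIdeal HilbertCube) := by
  rcases GdeltaFamily.eq_empty_or_nonempty with h0 | ⟨A, hA⟩
  · have hs : {c | ∃ 𝓐 : Set (Set HilbertCube), 𝓐 ⊆ sigmaG0 ∧ ⋃₀ 𝓐 = Set.univ ∧ c = #𝓐} = ∅ := by
      refine eq_empty_of_forall_notMem ?_
      rintro c ⟨𝓐, h𝓐, huniv, -⟩
      obtain ⟨B, hB, -⟩ := eq_univ_iff_forall.1 huniv fun _ => 0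
      obtain ⟨S, hS, -⟩ := h𝓐 hB
      exact notMem_empty _ (h0 ▸ hS 0)
    rw [covIdeal, hs, Cardinal.sInf_empty]
    exact zero_le
  · obtain ⟨𝓜, hM, hunion, hcard⟩ : addIdeal (MeagerIdeal HilbertCube) ∈
        {c | ∃ 𝓐 : Set (Set HilbertCube), 𝓐 ⊆ MeagerIdeal HilbertCube ∧
          ⋃₀ 𝓐 ∉ MeagerIdeal HilbertCube ∧ c = #𝓐} :=
      csInf_mem ⟨_, _, Subset.rfl, not_isMeagre_sUnion_meagerIdeal, rfl⟩
    obtain ⟨h, hh⟩ := exists_homeomorph_family hM hunion hA.1 hA.2.1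
    rw [hcard]
    refine (covIdeal_le_mk (𝓐 := range fun M => (h M).symm '' A) ?_ ?_).trans mk_range_le
    · rintro _ ⟨M, rfl⟩
      exact mem_sigmaG0_of_isMinimalDenseGdelta (IsMinimalDenseGdelta.image hA _)
    · refine eq_univ_of_forall fun x => ?_
      obtain ⟨M, hM⟩ := hh x
      exact ⟨_, mem_range_self M, h M x, hM, (h M).symm_apply_apply x⟩
end

section
/- For every zero-dimensional Z-set F ⊆ I^ω and every dense open subset G of I^ω, the set {h ∈ H(I^ω) : h(F) ⊆ G} is dense in H(I^ω). -/
open Set Topology Cardinal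

/-- Two points of the Hilbert cube are `(n, ε)`-near if their first `n` coordinates
differ by less than `ε`. -/
def CoordNear (n : ℕ) (ε : ℝ) (x z : HilbertCube) : Prop :=
  ∀ i < n, |(x i : ℝ) - z i| < ε

namespace CoordNear

theorem refl (n : ℕ) {ε : ℝ} (hε : 0 < ε) (x : HilbertCube) : CoordNear n ε x x :=
  fun i _ => by simpa using hε

theorem symm {n : ℕ} {ε : ℝ} {x z : HilbertCube} (h : CoordNear n ε x z) :
    CoordNear n ε z x := fun i hi => by rw [abs_sub_comm]; exact h i hi

theorem trans {n : ℕ} {ε δ : ℝ} {x y z : HilbertCube} (h : CoordNear n ε x y)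
    (h' : CoordNear n δ y z) : CoordNear n (ε + δ) x z := fun i hi =>
  (abs_sub_le _ (y i : ℝ) _).trans_lt (add_lt_add (h i hi) (h' i hi))

theorem mono {m n : ℕ} {ε δ : ℝ} {x z : HilbertCube} (h : CoordNear n ε x z)
    (hmn : m ≤ n) (hεδ : ε ≤ δ) : CoordNear m δ x z := fun i hi =>
  (h i (hi.trans_le hmn)).trans_le hεδ

end CoordNear

theorem setOf_coordNear_mem_uniformity (n : ℕ) {ε : ℝ} (hε : 0 < ε) :
    {p : HilbertCube × HilbertCube | CoordNear n ε p.1 p.2} ∈ uniformity HilbertCube := by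
  have : {p : HilbertCube × HilbertCube | CoordNear n ε p.1 p.2} =
      ⋂ i ∈ Finset.range n, {p | |(p.1 i : ℝ) - p.2 i| < ε} := by
    ext p; simp [CoordNear]
  rw [this, Filter.biInter_finset_mem]
  intro i _
  rw [Pi.uniformity]
  refine Filter.mem_iInf_of_mem i ?_
  exact ⟨{q | dist q.1 q.2 < ε}, Metric.dist_mem_uniformity hε, fun p hp => hp⟩

theorem exists_coordNear_of_mem_uniformity {V : Set (HilbertCube × HilbertCube)}
    (hV : V ∈ uniformity HilbertCube) :
    ∃ n : ℕ, ∃ ε > 0, ∀ x z, CoordNear n ε x z → (x, z) ∈ V := by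
  rw [Pi.uniformity] at hV
  refine Filter.iInf_sets_induct hV ⟨0, 1, one_pos, fun _ _ _ => mem_univ _⟩ ?_
  rintro i s₁ s₂ ⟨t, ht, hts⟩ ⟨n, ε, hε, h⟩
  obtain ⟨δ, hδ, hδt⟩ := Metric.mem_uniformity_dist.1 ht
  refine ⟨max n (i + 1), min ε δ, lt_min hε hδ, fun x z hxz => ⟨hts ?_, ?_⟩⟩
  · exact hδt ((hxz i (by simp)).trans_le (min_le_right _ _))
  · exact h x z (hxz.mono (le_max_left _ _) (min_le_left _ _))

theorem Continuous.exists_coordNear {φ : HilbertCube → HilbertCube} (hφ : Continuous φ)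
    (n : ℕ) {ε : ℝ} (hε : 0 < ε) :
    ∃ m : ℕ, ∃ δ > 0, ∀ x z, CoordNear m δ x z → CoordNear n ε (φ x) (φ z) :=
  exists_coordNear_of_mem_uniformity
    (CompactSpace.uniformContinuous_of_continuous hφ (setOf_coordNear_mem_uniformity n hε))

theorem IsCompact.exists_coordNear_subset {K U : Set HilbertCube} (hK : IsCompact K)
    (hU : IsOpen U) (hKU : K ⊆ U) :
    ∃ n : ℕ, ∃ ε > 0, ∀ x ∈ K, ∀ z, CoordNear n ε x z → z ∈ U := by
  obtain ⟨V, hV, -, h⟩ := lebesgue_number_of_compact_open hK hU hKU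
  obtain ⟨n, ε, hε, hn⟩ := exists_coordNear_of_mem_uniformity hV
  exact ⟨n, ε, hε, fun x hx z hxz => h x hx (hn x z hxz)⟩

theorem exists_coordNear_of_mem_nhds_homeomorph {h₀ : HilbertCube ≃ₜ HilbertCube}
    {s : Set (HilbertCube ≃ₜ HilbertCube)} (hs : s ∈ 𝓝 h₀) :
    ∃ n : ℕ, ∃ ε > 0, ∀ h : HilbertCube ≃ₜ HilbertCube,
      (∀ x, CoordNear n ε (h₀ x) (h x)) → h ∈ s := by
  rw [nhds_induced] at hs
  obtain ⟨t, ht, hts⟩ := hs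
  obtain ⟨V, hV, hVt⟩ := UniformSpace.mem_nhds_iff.1 ht
  obtain ⟨W, hW, hWV⟩ :=
    ContinuousMap.hasBasis_compactConvergenceUniformity_of_compact.mem_iff.1 hV
  obtain ⟨n, ε, hε, hn⟩ := exists_coordNear_of_mem_uniformity hW
  exact ⟨n, ε, hε, fun h hh => hts (hVt (hWV fun x => hn _ _ (hh x)))⟩

/-- A near-homeomorphism of the Hilbert cube: a uniform limit of homeomorphisms. -/
structure IsNearHomeo (φ : HilbertCube → HilbertCube) : Prop where
  continuous : Continuous φ
  exists_homeomorph (n : ℕ) (ε : ℝ) (hε : 0 < ε) :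
    ∃ h : HilbertCube ≃ₜ HilbertCube, ∀ x, CoordNear n ε (h x) (φ x)

theorem Homeomorph.isNearHomeo (h : HilbertCube ≃ₜ HilbertCube) : IsNearHomeo h :=
  ⟨h.continuous, fun n _ hε => ⟨h, fun x => CoordNear.refl n hε (h x)⟩⟩

theorem IsNearHomeo.comp {φ ψ : HilbertCube → HilbertCube} (hφ : IsNearHomeo φ)
    (hψ : IsNearHomeo ψ) : IsNearHomeo (φ ∘ ψ) := by
  refine ⟨hφ.continuous.comp hψ.continuous, fun n ε hε => ?_⟩
  obtain ⟨h₁, hh₁⟩ := hφ.exists_homeomorph n (ε / 2) (half_pos hε)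
  obtain ⟨m, δ, hδ, hm⟩ := hφ.continuous.exists_coordNear n (half_pos hε)
  obtain ⟨h₂, hh₂⟩ := hψ.exists_homeomorph m δ hδ
  refine ⟨h₂.trans h₁, fun x => ?_⟩
  have := (hh₁ (h₂ x)).trans (hm _ _ (hh₂ x))
  rwa [add_halves] at this

/-- A near-homeomorphism sending a compact set into an open set can be replaced by a
homeomorphism. -/
theorem IsNearHomeo.exists_homeomorph_mapsTo {φ : HilbertCube → HilbertCube}
    (hφ : IsNearHomeo φ) {K U : Set HilbertCube} (hK : IsCompact K) (hU : IsOpen U)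
    (hKU : MapsTo φ K U) (n : ℕ) {ε : ℝ} (hε : 0 < ε) :
    ∃ h : HilbertCube ≃ₜ HilbertCube, MapsTo h K U ∧ ∀ x, CoordNear n ε (h x) (φ x) := by
  obtain ⟨m, δ, hδ, hm⟩ :=
    (hK.image hφ.continuous).exists_coordNear_subset hU hKU.image_subset
  obtain ⟨h, hh⟩ := hφ.exists_homeomorph (max n m) (min ε δ) (lt_min hε hδ)
  refine ⟨h, fun x hx => hm _ (mem_image_of_mem φ hx) _ ?_, fun x => ?_⟩
  · exact ((hh x).mono (le_max_right _ _) (min_le_right _ _)).symm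
  · exact (hh x).mono (le_max_left _ _) (min_le_left _ _)

/-- Replace every coordinate `x i`, `i ∈ S`, by `g i x (x i)`. -/
def fiberMap (S : Finset ℕ) (g : ℕ → HilbertCube → ↥(Set.Icc (0:ℝ) 1) → ↥(Set.Icc (0:ℝ) 1))
    (x : HilbertCube) : HilbertCube :=
  fun i => if i ∈ S then g i x (x i) else x i

section FiberMap

variable {S : Finset ℕ} {g : ℕ → HilbertCube → ↥(Set.Icc (0:ℝ) 1) → ↥(Set.Icc (0:ℝ) 1)}

theorem continuous_fiberMap
    (hg : ∀ i, Continuous fun p : HilbertCube × ↥(Set.Icc (0:ℝ) 1) => g i p.1 p.2) :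
    Continuous (fiberMap S g) := by
  refine continuous_pi fun i => ?_
  unfold fiberMap
  split_ifs
  · exact (hg i).comp (continuous_id.prodMk (continuous_apply i))
  · exact continuous_apply i

theorem bijective_fiberMap
    (hg : ∀ i, Continuous fun p : HilbertCube × ↥(Set.Icc (0:ℝ) 1) => g i p.1 p.2)
    (hmono : ∀ i x, StrictMono (g i x)) (hzero : ∀ i x, g i x 0 = 0)
    (hone : ∀ i x, g i x 1 = 1)
    (hdep : ∀ i ∈ S, ∀ x z, (∀ j ∉ S, x j = z j) → g i x = g i z) :
    Function.Bijective (fiberMap S g) := by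
  constructor
  · intro x z hxz
    have hoff : ∀ j ∉ S, x j = z j := fun j hj => by
      simpa [fiberMap, hj] using congrFun hxz j
    funext i
    by_cases hi : i ∈ S
    · have := congrFun hxz i
      simp only [fiberMap, hi, if_true, hdep i hi x z hoff] at this
      exact (hmono i z).injective this
    · exact hoff i hi
  · intro z
    have hsurj : ∀ i, ∃ t, g i z t = z i := fun i =>
      mem_range_of_exists_le_of_exists_ge ((hg i).comp (Continuous.prodMk_right z))
        ⟨0, by simp [hzero]⟩ ⟨1, by rw [hone]; exact (z i).2.2⟩
    choose t ht using hsurj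
    refine ⟨fun i => if i ∈ S then t i else z i, ?_⟩
    funext i
    by_cases hi : i ∈ S
    · simp only [fiberMap, hi, if_true]
      rw [hdep i hi _ z fun j hj => by simp [hj], ht]
    · simp [fiberMap, hi]

/-- Coordinatewise monotone maps depending only on unchanged coordinates are
near-homeomorphisms. -/
theorem isNearHomeo_fiberMap
    (hg : ∀ i, Continuous fun p : HilbertCube × ↥(Set.Icc (0:ℝ) 1) => g i p.1 p.2)
    (hmono : ∀ i x, Monotone (g i x)) (hzero : ∀ i x, g i x 0 = 0)
    (hone : ∀ i x, g i x 1 = 1)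
    (hdep : ∀ i ∈ S, ∀ x z, (∀ j ∉ S, x j = z j) → g i x = g i z) :
    IsNearHomeo (fiberMap S g) := by
  refine ⟨continuous_fiberMap hg, fun n ε hε => ?_⟩
  obtain ⟨τ, hτ0, hτ⟩ := exists_between (lt_min hε one_pos)
  have hτε := hτ.trans_le (min_le_left _ _)
  have hτ1 := hτ.trans_le (min_le_right _ _)
  let k : ℕ → HilbertCube → ↥(Set.Icc (0:ℝ) 1) → ↥(Set.Icc (0:ℝ) 1) := fun i x t =>
    ⟨(1 - τ) * g i x t + τ * t, by
      have h1 := (g i x t).2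
      have h2 := t.2
      constructor
      · have := mul_nonneg (sub_nonneg.2 hτ1.le) h1.1
        have := mul_nonneg hτ0.le h2.1
        linarith
      · have := mul_le_mul_of_nonneg_left h1.2 (sub_nonneg.2 hτ1.le)
        have := mul_le_mul_of_nonneg_left h2.2 hτ0.le
        linarith⟩
  have hk : ∀ i, Continuous fun p : HilbertCube × ↥(Set.Icc (0:ℝ) 1) => k i p.1 p.2 := by
    intro i
    have := hg i
    refine Continuous.subtype_mk ?_ _
    fun_prop
  have hbij : Function.Bijective (fiberMap S k) := by
    refine bijective_fiberMap hk ?_ ?_ ?_ ?_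
    · intro i x s t hst
      have h1 : (g i x s : ℝ) ≤ g i x t := hmono i x hst.le
      have h2 : (s : ℝ) < t := hst
      change (1 - τ) * (g i x s : ℝ) + τ * s < (1 - τ) * g i x t + τ * t
      have := mul_le_mul_of_nonneg_left h1 (sub_nonneg.2 hτ1.le)
      have := mul_lt_mul_of_pos_left h2 hτ0
      linarith
    · intro i x
      ext
      simp [k, hzero]
    · intro i x
      ext
      simp [k, hone]
    · intro i hi x z h
      funext t
      simp only [k, hdep i hi x z h]
  have hcont : Continuous (Equiv.ofBijective _ hbij) := continuous_fiberMap hk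
  refine ⟨hcont.homeoOfEquivCompactToT2, fun x i _ => ?_⟩
  change |((fiberMap S k x i : ↥(Set.Icc (0:ℝ) 1)) : ℝ) - fiberMap S g x i| < ε
  by_cases hi : i ∈ S
  · simp only [fiberMap, hi, if_true, k]
    have h1 := (g i x (x i)).2
    have h2 := (x i).2
    rw [show (1 - τ) * (g i x (x i) : ℝ) + τ * x i - g i x (x i) =
      τ * (x i - g i x (x i)) by ring, abs_mul, abs_of_pos hτ0]
    have : |(x i : ℝ) - g i x (x i)| ≤ 1 := abs_le.2 ⟨by linarith [h1.2, h2.1],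
      by linarith [h1.1, h2.2]⟩
    have := mul_le_mul_of_nonneg_left this hτ0.le
    linarith
  · simpa [fiberMap, hi] using hε

end FiberMap

/-- The piecewise linear map fixing `0` and `1` and sending the interval `[l, r]` to `q`. -/
noncomputable def bend (l r q t : ℝ) : ℝ :=
  q * min (t / l) 1 + (1 - q) * max 0 ((t - r) / (1 - r))

theorem bend_monotone {l r q : ℝ} (hl : 0 < l) (hr : r < 1) (hq : q ∈ Set.Icc (0:ℝ) 1) :
    Monotone (bend l r q) := by
  intro s t hst
  have hr' : 0 < 1 - r := sub_pos.2 hr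
  have hq' : 0 ≤ 1 - q := sub_nonneg.2 hq.2
  have hq0 := hq.1
  unfold bend
  gcongr

theorem bend_zero {l r q : ℝ} (hr0 : 0 ≤ r) (hr : r < 1) : bend l r q 0 = 0 := by
  have : (0 - r) / (1 - r) ≤ 0 := div_nonpos_of_nonpos_of_nonneg (by linarith) (by linarith)
  simp only [bend, max_eq_left this, zero_div, min_eq_left zero_le_one, mul_zero, add_zero]

theorem bend_one {l r q : ℝ} (hl : 0 < l) (hl1 : l ≤ 1) (hr : r < 1) : bend l r q 1 = 1 := by
  have h1 : 1 ≤ 1 / l := (one_le_div hl).2 hl1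
  have h2 : (1 - r) / (1 - r) = 1 := div_self (by linarith)
  simp only [bend, min_eq_right h1, h2]
  norm_num

theorem bend_of_mem {l r q t : ℝ} (hl : 0 < l) (hr : r < 1) (ht : t ∈ Set.Icc l r) :
    bend l r q t = q := by
  have h1 : 1 ≤ t / l := (one_le_div hl).2 ht.1
  have h2 : (t - r) / (1 - r) ≤ 0 :=
    div_nonpos_of_nonpos_of_nonneg (by linarith [ht.2]) (by linarith)
  simp [bend, min_eq_right h1, max_eq_left h2]

theorem bend_mem {l r q t : ℝ} (hl : 0 < l) (hl1 : l ≤ 1) (hr0 : 0 ≤ r) (hr : r < 1)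
    (hq : q ∈ Set.Icc (0:ℝ) 1) (ht : t ∈ Set.Icc (0:ℝ) 1) : bend l r q t ∈ Set.Icc (0:ℝ) 1 := by
  constructor
  · rw [← bend_zero (l := l) (q := q) hr0 hr]
    exact bend_monotone hl hr hq ht.1
  · rw [← bend_one (q := q) hl hl1 hr]
    exact bend_monotone hl hr hq ht.2

theorem abs_bend_sub_le {p q t : ℝ} (hp : 0 < p) (hp1 : p < 1) (ht : t ∈ Set.Icc (0:ℝ) 1) :
    |bend p p q t - t| ≤ |q - p| := by
  have hp' : 0 < 1 - p := sub_pos.2 hp1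
  rcases le_total t p with h | h
  · have h1 : t / p ≤ 1 := (div_le_one hp).2 h
    have h2 : (t - p) / (1 - p) ≤ 0 :=
      div_nonpos_of_nonpos_of_nonneg (by linarith) hp'.le
    have : bend p p q t - t = (t / p) * (q - p) := by
      rw [bend, min_eq_left h1, max_eq_left h2]; field_simp; ring
    rw [this, abs_mul, abs_of_nonneg (div_nonneg ht.1 hp.le)]
    exact mul_le_of_le_one_left (abs_nonneg _) h1
  · have h1 : 1 ≤ t / p := (one_le_div hp).2 h
    have h2 : 0 ≤ (t - p) / (1 - p) := div_nonneg (by linarith) hp'.le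
    have h3 : (1 - t) / (1 - p) ≤ 1 := (div_le_one hp').2 (by linarith)
    have : bend p p q t - t = ((1 - t) / (1 - p)) * (q - p) := by
      rw [bend, min_eq_right h1, max_eq_right h2]; field_simp; ring
    rw [this, abs_mul, abs_of_nonneg (div_nonneg (by linarith [ht.2]) hp'.le)]
    exact mul_le_of_le_one_left (abs_nonneg _) h3

/-- Bend every coordinate `x i`, `i ∈ S`, with parameters depending on `x`. -/
noncomputable def bendMap (S : Finset ℕ) (l r q : ℕ → HilbertCube → ℝ) : HilbertCube → HilbertCube :=
  fiberMap S fun i x t => Set.projIcc 0 1 zero_le_one (bend (l i x) (r i x) (q i x) t)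

section BendMap

variable {S : Finset ℕ} {l r q : ℕ → HilbertCube → ℝ}

theorem isNearHomeo_bendMap (hlc : ∀ i, Continuous (l i)) (hrc : ∀ i, Continuous (r i))
    (hqc : ∀ i, Continuous (q i)) (hl : ∀ i x, l i x ∈ Set.Ioo (0:ℝ) 1)
    (hr : ∀ i x, r i x ∈ Set.Ioo (0:ℝ) 1) (hq : ∀ i x, q i x ∈ Set.Icc (0:ℝ) 1)
    (hdep : ∀ i ∈ S, ∀ x z, (∀ j ∉ S, x j = z j) → l i x = l i z ∧ r i x = r i z ∧ q i x = q i z) :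
    IsNearHomeo (bendMap S l r q) := by
  refine isNearHomeo_fiberMap (fun i => ?_) (fun i x s t hst => ?_) (fun i x => ?_)
    (fun i x => ?_) (fun i hi x z h => ?_)
  · have h1 := hlc i
    have h2 := hrc i
    have h3 := hqc i
    have h4 : ∀ x, l i x ≠ 0 := fun x => (hl i x).1.ne'
    have h5 : ∀ x, 1 - r i x ≠ 0 := fun x => (sub_pos.2 (hr i x).2).ne'
    unfold bend
    refine continuous_projIcc.comp ?_
    fun_prop (disch := simp [h4, h5])
  · exact monotone_projIcc _ (bend_monotone (hl i x).1 (hr i x).2 (hq i x) hst)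
  · simp [bend_zero (hr i x).1.le (hr i x).2]
  · simp [bend_one (hl i x).1 (hl i x).2.le (hr i x).2]
  · obtain ⟨h1, h2, h3⟩ := hdep i hi x z h
    simp only [h1, h2, h3]

theorem bendMap_apply_of_notMem {i : ℕ} (hi : i ∉ S) (x : HilbertCube) :
    bendMap S l r q x i = x i := by simp [bendMap, fiberMap, hi]

theorem bendMap_apply_of_mem {i : ℕ} (hi : i ∈ S) {x : HilbertCube}
    (hl : l i x ∈ Set.Ioo (0:ℝ) 1) (hr : r i x ∈ Set.Ioo (0:ℝ) 1)
    (hq : q i x ∈ Set.Icc (0:ℝ) 1) :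
    (bendMap S l r q x i : ℝ) = bend (l i x) (r i x) (q i x) (x i) := by
  simp only [bendMap, fiberMap, hi, if_true]
  rw [projIcc_of_mem _ (bend_mem hl.1 hl.2.le hr.1.le hr.2 hq (x i).2)]

end BendMap

/-- A norm-preserving, positively homogeneous version of the shear `(a, b) ↦ (a, b - β a)`. -/
noncomputable def turn (β : ℝ) (w : ℝ × ℝ) : ℝ × ℝ :=
  (‖w‖ / ‖(w.1, w.2 - β * w.1)‖) • (w.1, w.2 - β * w.1)

theorem shear_ne_zero {β : ℝ} {w : ℝ × ℝ} (hw : w ≠ 0) : (w.1, w.2 - β * w.1) ≠ 0 := by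
  intro h
  rw [Prod.mk_eq_zero] at h
  apply hw
  ext
  · exact h.1
  · simpa [h.1] using h.2

theorem norm_turn (β : ℝ) (w : ℝ × ℝ) : ‖turn β w‖ = ‖w‖ := by
  by_cases hw : w = 0
  · simp [hw, turn]
  · rw [turn, norm_smul, norm_div, norm_norm, norm_norm,
      div_mul_cancel₀ _ (norm_ne_zero_iff.2 (shear_ne_zero hw))]

theorem continuous_turn (β : ℝ) : Continuous (turn β) := by
  rw [continuous_iff_continuousAt]
  intro w
  by_cases hw : w = 0
  · subst hw
    have h0 : turn β 0 = 0 := by simp [turn]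
    rw [ContinuousAt, h0, tendsto_zero_iff_norm_tendsto_zero]
    simp only [norm_turn]
    exact tendsto_norm_zero
  · have h : ‖(w.1, w.2 - β * w.1)‖ ≠ 0 := norm_ne_zero_iff.2 (shear_ne_zero hw)
    have hc : Continuous fun w : ℝ × ℝ => (w.1, w.2 - β * w.1) := by fun_prop
    exact (continuous_norm.continuousAt.div hc.norm.continuousAt h).smul hc.continuousAt

theorem turn_neg_turn (β : ℝ) (w : ℝ × ℝ) : turn (-β) (turn β w) = w := by
  by_cases hw : w = 0
  · simp [hw, turn]
  have h : ‖(w.1, w.2 - β * w.1)‖ ≠ 0 := norm_ne_zero_iff.2 (shear_ne_zero hw)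
  have hw' : ‖w‖ ≠ 0 := norm_ne_zero_iff.2 hw
  have key : ((turn β w).1, (turn β w).2 - -β * (turn β w).1) =
      (‖w‖ / ‖(w.1, w.2 - β * w.1)‖) • w := by
    ext
    · simp [turn]
    · simp only [turn, Prod.smul_snd, Prod.smul_fst, smul_eq_mul]; ring
  rw [turn, key, norm_turn, norm_smul, norm_div, norm_norm, norm_norm, smul_smul]
  rw [show ‖w‖ / (‖w‖ / ‖(w.1, w.2 - β * w.1)‖ * ‖w‖) * (‖w‖ / ‖(w.1, w.2 - β * w.1)‖) = 1 by
    field_simp, one_smul]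

theorem turn_fst_nonneg {β : ℝ} {w : ℝ × ℝ} (hw : 0 ≤ w.1) : 0 ≤ (turn β w).1 :=
  mul_nonneg (by positivity) hw

theorem turn_of_fst_eq_zero {β b : ℝ} : turn β (0, b) = (0, b) := by
  by_cases hb : b = 0
  · subst hb; simp [turn, ← Prod.zero_eq_mk]
  · have : ‖((0:ℝ), b)‖ ≠ 0 := norm_ne_zero_iff.2 (by simpa using hb)
    simp [turn, hb]

/-- The left and lower sides of the unit square around `(1, 0)` are turned into the right half
of the lower side. -/
theorem turn_three {a b : ℝ} (ha0 : 0 ≤ a) (hba : b ≤ a)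
    (hnorm : ‖(a, b)‖ = 1) : (turn 3 (a, b)).2 = -1 ∧ (turn 3 (a, b)).1 ≤ 1 / 2 := by
  have hw : (a, b) ≠ 0 := by rw [← norm_ne_zero_iff, hnorm]; norm_num
  have hn : ‖(a, b - 3 * a)‖ = 3 * a - b := by
    rw [Prod.norm_def, Real.norm_of_nonneg ha0, Real.norm_of_nonpos (by linarith),
      max_eq_right (by linarith)]
    ring
  have hpos : 0 < 3 * a - b := hn ▸ norm_pos_iff.2 (shear_ne_zero (β := 3) hw)
  simp only [turn, hnorm, hn, Prod.smul_mk, smul_eq_mul]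
  constructor
  · field_simp; ring
  · rw [one_div, inv_mul_le_iff₀ hpos]; linarith

/-- The effect of `turn` on the strip `[0, d] × [0, 1]`, seen from the midpoint of its right
side. -/
noncomputable def stripTurn (β d : ℝ) (p : ℝ × ℝ) : ℝ × ℝ :=
  (max p.1 d - d * (turn β (max 0 (1 - p.1 / d), 2 * p.2 - 1)).1,
    ((turn β (max 0 (1 - p.1 / d), 2 * p.2 - 1)).2 + 1) / 2)

theorem continuous_stripTurn (β d : ℝ) : Continuous (stripTurn β d) := by
  have h : Continuous fun p : ℝ × ℝ => turn β (max 0 (1 - p.1 / d), 2 * p.2 - 1) :=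
    (continuous_turn β).comp (by fun_prop)
  exact ((continuous_fst.max continuous_const).sub (continuous_const.mul h.fst)).prodMk
    ((h.snd.add continuous_const).div_const 2)

theorem stripTurn_of_le {β d : ℝ} (hd : 0 < d) {p : ℝ × ℝ} (hp : d ≤ p.1) :
    stripTurn β d p = p := by
  have h1 : 1 - p.1 / d ≤ 0 := sub_nonpos.2 ((one_le_div hd).2 hp)
  ext
  · simp [stripTurn, max_eq_left h1, max_eq_left hp, turn_of_fst_eq_zero]
  · simp only [stripTurn, max_eq_left h1, turn_of_fst_eq_zero]; ring

theorem strip_norm_le {d : ℝ} (hd : 0 < d) {p : ℝ × ℝ} (h1 : 0 ≤ p.1)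
    (h2 : p.2 ∈ Set.Icc (0:ℝ) 1) : ‖(max 0 (1 - p.1 / d), 2 * p.2 - 1)‖ ≤ 1 := by
  rw [Prod.norm_def, max_le_iff]
  constructor
  · rw [Real.norm_of_nonneg (le_max_left _ _)]
    exact max_le zero_le_one (by linarith [div_nonneg h1 hd.le])
  · exact abs_le.2 ⟨by linarith [h2.1], by linarith [h2.2]⟩

theorem stripTurn_spec {β d : ℝ} (hd : 0 < d) {p : ℝ × ℝ} (h1 : 0 ≤ p.1)
    (h2 : p.2 ∈ Set.Icc (0:ℝ) 1) :
    (stripTurn β d p).2 ∈ Set.Icc (0:ℝ) 1 ∧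
      (p.1 ≤ d → (stripTurn β d p).1 ∈ Set.Icc 0 d) := by
  have hn := (norm_turn β _).trans_le (strip_norm_le hd h1 h2)
  rw [Prod.norm_def, max_le_iff, Real.norm_eq_abs, Real.norm_eq_abs] at hn
  refine ⟨⟨?_, ?_⟩, fun hp => ?_⟩
  · have := (abs_le.1 hn.2).1
    simp only [stripTurn]; linarith
  · have := (abs_le.1 hn.2).2
    simp only [stripTurn]; linarith
  · have h3 := (abs_le.1 hn.1).2
    have h4 : 0 ≤ (turn β (max 0 (1 - p.1 / d), 2 * p.2 - 1)).1 :=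
      turn_fst_nonneg (le_max_left _ _)
    simp only [stripTurn, max_eq_right hp, mem_Icc]
    constructor <;> nlinarith

theorem stripTurn_mem {β d : ℝ} (hd : 0 < d) (hd1 : d ≤ 1) {p : ℝ × ℝ}
    (h1 : p.1 ∈ Set.Icc (0:ℝ) 1) (h2 : p.2 ∈ Set.Icc (0:ℝ) 1) :
    (stripTurn β d p).1 ∈ Set.Icc (0:ℝ) 1 ∧ (stripTurn β d p).2 ∈ Set.Icc (0:ℝ) 1 := by
  have h := stripTurn_spec (β := β) hd h1.1 h2
  refine ⟨?_, h.1⟩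
  rcases le_total p.1 d with hp | hp
  · exact ⟨(h.2 hp).1, (h.2 hp).2.trans hd1⟩
  · rwa [stripTurn_of_le hd hp]

theorem stripTurn_neg_stripTurn {β d : ℝ} (hd : 0 < d) {p : ℝ × ℝ} (h1 : 0 ≤ p.1)
    (h2 : p.2 ∈ Set.Icc (0:ℝ) 1) : stripTurn (-β) d (stripTurn β d p) = p := by
  rcases le_total d p.1 with hp | hp
  · rw [stripTurn_of_le hd hp, stripTurn_of_le hd hp]
  · have h := (stripTurn_spec (β := β) hd h1 h2).2 hp
    set w : ℝ × ℝ := (max 0 (1 - p.1 / d), 2 * p.2 - 1) with hw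
    have e1 : (stripTurn β d p).1 = d - d * (turn β w).1 := by
      simp only [stripTurn, max_eq_right hp, hw]
    have e2 : (stripTurn β d p).2 = ((turn β w).2 + 1) / 2 := rfl
    have e3 : (max 0 (1 - (stripTurn β d p).1 / d), 2 * (stripTurn β d p).2 - 1) = turn β w := by
      ext
      · have : 1 - (stripTurn β d p).1 / d = (turn β w).1 := by
          rw [e1]; field_simp; ring
        rw [this]
        exact max_eq_right (turn_fst_nonneg (le_max_left _ _))
      · simp only [e2]; ring
    have h3 : w.1 = 1 - p.1 / d := max_eq_right (sub_nonneg.2 ((div_le_one hd).2 hp))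
    rw [stripTurn, e3, turn_neg_turn, max_eq_right h.2, h3]
    ext
    · simp only; field_simp; ring
    · simp only [hw]; ring

theorem abs_stripTurn_fst_sub_le {β d : ℝ} (hd : 0 < d) {p : ℝ × ℝ} (h1 : 0 ≤ p.1)
    (h2 : p.2 ∈ Set.Icc (0:ℝ) 1) : |(stripTurn β d p).1 - p.1| ≤ d := by
  rcases le_total d p.1 with hp | hp
  · rw [stripTurn_of_le hd hp]; simpa using hd.le
  · have h := (stripTurn_spec (β := β) hd h1 h2).2 hp
    exact abs_le.2 ⟨by linarith [h.1], by linarith [h.2]⟩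

theorem stripTurn_three {d : ℝ} (hd : 0 < d) {p : ℝ × ℝ} (h1 : 0 ≤ p.1)
    (h2 : p.2 ∈ Set.Icc (0:ℝ) 1) (h : p.1 = 0 ∨ p.2 = 0) :
    (stripTurn 3 d p).2 = 0 ∧ d / 2 ≤ (stripTurn 3 d p).1 := by
  have hle := strip_norm_le hd h1 h2
  have key : (turn 3 (max 0 (1 - p.1 / d), 2 * p.2 - 1)).2 = -1 ∧
      (turn 3 (max 0 (1 - p.1 / d), 2 * p.2 - 1)).1 ≤ 1 / 2 := by
    refine turn_three (le_max_left _ _) ?_ (le_antisymm hle ?_)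
    · rcases h with h | h
      · rw [h, zero_div, sub_zero, max_eq_right zero_le_one]; linarith [h2.2]
      · rw [h]; exact le_trans (by norm_num) (le_max_left _ _)
    · rw [Prod.norm_def]
      rcases h with h | h
      · exact le_max_of_le_left (by simp [h])
      · exact le_max_of_le_right (by simp [h])
  constructor
  · simp only [stripTurn, key.1]; norm_num
  · have := le_max_right p.1 d
    simp only [stripTurn]
    nlinarith [key.2]

/-- Apply `stripTurn` to the coordinates `x i` and `x k`. -/
noncomputable def coordTurn (β d : ℝ) (i k : ℕ) (x : HilbertCube) : HilbertCube :=
  Function.update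
    (Function.update x i (Set.projIcc 0 1 zero_le_one (stripTurn β d (x i, x k)).1)) k
    (Set.projIcc 0 1 zero_le_one (stripTurn β d (x i, x k)).2)

section CoordTurn

variable {β d : ℝ} {i k : ℕ}

theorem continuous_coordTurn : Continuous (coordTurn β d i k) := by
  have := continuous_stripTurn β d
  have h : Continuous fun x : HilbertCube => stripTurn β d (x i, x k) := by fun_prop
  exact (continuous_id.update i (continuous_projIcc.comp h.fst)).update k
    (continuous_projIcc.comp h.snd)

theorem coordTurn_apply_of_ne {j : ℕ} (hi : j ≠ i) (hk : j ≠ k) (x : HilbertCube) :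
    coordTurn β d i k x j = x j := by simp [coordTurn, hi, hk]

theorem coordTurn_apply_fst (hd : 0 < d) (hd1 : d ≤ 1) (hik : i ≠ k) (x : HilbertCube) :
    (coordTurn β d i k x i : ℝ) = (stripTurn β d (x i, x k)).1 := by
  simp only [coordTurn, Function.update_of_ne hik, Function.update_self]
  rw [projIcc_of_mem _ (stripTurn_mem hd hd1 (x i).2 (x k).2).1]

theorem coordTurn_apply_snd (hd : 0 < d) (hd1 : d ≤ 1) (x : HilbertCube) :
    (coordTurn β d i k x k : ℝ) = (stripTurn β d (x i, x k)).2 := by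
  simp only [coordTurn, Function.update_self]
  rw [projIcc_of_mem _ (stripTurn_mem hd hd1 (x i).2 (x k).2).2]

theorem coordTurn_neg_coordTurn (hd : 0 < d) (hd1 : d ≤ 1) (hik : i ≠ k) (x : HilbertCube) :
    coordTurn (-β) d i k (coordTurn β d i k x) = x := by
  have h := stripTurn_neg_stripTurn (β := β) hd (p := (↑(x i), ↑(x k))) (x i).2.1 (x k).2
  funext j
  by_cases hi : j = i
  · subst hi
    ext
    rw [coordTurn_apply_fst hd hd1 hik, coordTurn_apply_fst hd hd1 hik,
      coordTurn_apply_snd hd hd1, Prod.mk.eta, h]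
  by_cases hk : j = k
  · subst hk
    ext
    rw [coordTurn_apply_snd hd hd1, coordTurn_apply_fst hd hd1 hik,
      coordTurn_apply_snd hd hd1, Prod.mk.eta, h]
  · rw [coordTurn_apply_of_ne hi hk, coordTurn_apply_of_ne hi hk]

/-- `coordTurn` as a homeomorphism. -/
noncomputable def coordTurnHomeo (hd : 0 < d) (hd1 : d ≤ 1) (hik : i ≠ k) :
    HilbertCube ≃ₜ HilbertCube where
  toFun := coordTurn 3 d i k
  invFun := coordTurn (-3) d i k
  left_inv := coordTurn_neg_coordTurn hd hd1 hik
  right_inv x := by simpa using coordTurn_neg_coordTurn (β := -3) hd hd1 hik x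
  continuous_toFun := continuous_coordTurn
  continuous_invFun := continuous_coordTurn

end CoordTurn

/-- Reflection of the `i`-th coordinate. -/
def coordFlip (i : ℕ) : HilbertCube ≃ₜ HilbertCube where
  toFun x := Function.update x i (unitInterval.symm (x i))
  invFun x := Function.update x i (unitInterval.symm (x i))
  left_inv x := by simp
  right_inv x := by simp
  continuous_toFun := continuous_id.update i (unitInterval.continuous_symm.comp (continuous_apply i))
  continuous_invFun := continuous_id.update i (unitInterval.continuous_symm.comp (continuous_apply i))

theorem coordFlip_apply_self (i : ℕ) (x : HilbertCube) :
    (coordFlip i x i : ℝ) = 1 - x i := by simp [coordFlip]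

theorem coordFlip_apply_of_ne {i j : ℕ} (h : j ≠ i) (x : HilbertCube) :
    coordFlip i x j = x j := by simp [coordFlip, h]

theorem exists_homeomorph_push_zero {d : ℝ} {i k : ℕ} (hd : 0 < d) (hd1 : d ≤ 1)
    (hik : i ≠ k) :
    ∃ h : HilbertCube ≃ₜ HilbertCube, ∀ x,
      (∀ j, j ≠ i → j ≠ k → h x j = x j) ∧ |(h x i : ℝ) - x i| ≤ d ∧
      (d ≤ x i → h x = x) ∧
      ((x i : ℝ) = 0 ∨ (x k : ℝ) = 0 → (h x k : ℝ) = 0 ∧ d / 2 ≤ h x i) := by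
  refine ⟨coordTurnHomeo hd hd1 hik, fun x => ⟨fun j hi hk => coordTurn_apply_of_ne hi hk x,
    ?_, fun hx => ?_, fun hx => ?_⟩⟩
  · change |(coordTurn 3 d i k x i : ℝ) - x i| ≤ d
    rw [coordTurn_apply_fst hd hd1 hik]
    exact abs_stripTurn_fst_sub_le hd (p := (↑(x i), ↑(x k))) (x i).2.1 (x k).2
  · change coordTurn 3 d i k x = x
    simp [coordTurn, stripTurn_of_le hd (p := (↑(x i), ↑(x k))) hx]
  · change (coordTurn 3 d i k x k : ℝ) = 0 ∧ d / 2 ≤ (coordTurn 3 d i k x i : ℝ)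
    rw [coordTurn_apply_fst hd hd1 hik, coordTurn_apply_snd hd hd1]
    exact stripTurn_three hd (p := (↑(x i), ↑(x k))) (x i).2.1 (x k).2 hx

theorem exists_homeomorph_push_one {d : ℝ} {i k : ℕ} (hd : 0 < d) (hd1 : d ≤ 1)
    (hik : i ≠ k) :
    ∃ h : HilbertCube ≃ₜ HilbertCube, ∀ x,
      (∀ j, j ≠ i → j ≠ k → h x j = x j) ∧ |(h x i : ℝ) - x i| ≤ d ∧
      ((x i : ℝ) ≤ 1 - d → h x = x) ∧
      ((x i : ℝ) = 1 ∨ (x k : ℝ) = 0 → (h x k : ℝ) = 0 ∧ h x i ≤ 1 - d / 2) := by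
  obtain ⟨h, hh⟩ := exists_homeomorph_push_zero hd hd1 hik
  refine ⟨((coordFlip i).trans h).trans (coordFlip i), fun x => ?_⟩
  obtain ⟨h1, h2, h3, h4⟩ := hh (coordFlip i x)
  simp only [Homeomorph.trans_apply, coordFlip_apply_self, coordFlip_apply_of_ne hik.symm] at *
  refine ⟨fun j hi hk => ?_, ?_, fun hx => ?_, fun hx => ?_⟩
  · rw [coordFlip_apply_of_ne hi, h1 j hi hk, coordFlip_apply_of_ne hi]
  · rw [abs_sub_comm]
    convert h2 using 2; ring
  · rw [h3 (by linarith)]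
    simp [coordFlip]
  · obtain ⟨h5, h6⟩ := h4 (hx.imp (fun h => by linarith) id)
    exact ⟨h5, by linarith⟩

theorem exists_homeomorph_push {d : ℝ} {i k : ℕ} (hd : 0 < d) (hd1 : d ≤ 1 / 4)
    (hik : i ≠ k) :
    ∃ h : HilbertCube ≃ₜ HilbertCube, ∀ x,
      (∀ j, j ≠ i → j ≠ k → h x j = x j) ∧ |(h x i : ℝ) - x i| ≤ 2 * d ∧
      ((x i : ℝ) = 0 ∨ (x i : ℝ) = 1 ∨ (x k : ℝ) = 0 →
        (h x k : ℝ) = 0 ∧ (h x i : ℝ) ∈ Set.Icc (d / 2) (1 - d / 2)) := by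
  obtain ⟨h, hh⟩ := exists_homeomorph_push_zero hd (by linarith) hik
  obtain ⟨g, hg⟩ := exists_homeomorph_push_one hd (by linarith) hik
  refine ⟨h.trans g, fun x => ?_⟩
  obtain ⟨h1, h2, h3, h4⟩ := hh x
  obtain ⟨g1, g2, g3, g4⟩ := hg (h x)
  rw [Homeomorph.trans_apply]
  refine ⟨fun j hi hk => (g1 j hi hk).trans (h1 j hi hk), ?_, fun hx => ?_⟩
  · linarith [abs_sub_le (g (h x) i : ℝ) (h x i) (x i)]
  · have hx' : ((h x i : ℝ) = 1 ∨ (h x k : ℝ) = 0) ∧ d / 2 ≤ h x i := by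
      by_cases h0 : (x i : ℝ) = 0 ∨ (x k : ℝ) = 0
      · exact ⟨Or.inr (h4 h0).1, (h4 h0).2⟩
      · have h1 : (x i : ℝ) = 1 := by tauto
        rw [h3 (by linarith)]
        exact ⟨Or.inl h1, by linarith⟩
    obtain ⟨g5, g6⟩ := g4 hx'.1
    refine ⟨g5, ?_, g6⟩
    rcases le_total (h x i : ℝ) (1 - d) with hle | hle
    · rw [g3 hle]; exact hx'.2
    · linarith [(abs_le.1 g2).1]

theorem exists_homeomorph_push_finset {d : ℝ} {k : ℕ} (hd : 0 < d) (hd1 : d ≤ 1 / 4)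
    (T : Finset ℕ) (hk : k ∉ T) :
    ∃ h : HilbertCube ≃ₜ HilbertCube, ∀ x,
      (∀ j, j ∉ T → j ≠ k → h x j = x j) ∧ (∀ j, j ≠ k → |(h x j : ℝ) - x j| ≤ 2 * d) ∧
      (((x k : ℝ) = 0 ∨ ∃ i ∈ T, (x i : ℝ) = 0 ∨ (x i : ℝ) = 1) → (h x k : ℝ) = 0) ∧
      ((x k : ℝ) = 0 → ∀ i ∈ T, (h x i : ℝ) ∈ Set.Icc (d / 2) (1 - d / 2)) := by
  induction T using Finset.induction_on with
  | empty =>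
    refine ⟨Homeomorph.refl _, fun x => ⟨fun _ _ _ => rfl, fun j _ => ?_, ?_, ?_⟩⟩
    · simpa using hd.le
    · simp
    · simp
  | insert i T hi ih =>
    rw [Finset.mem_insert, not_or] at hk
    obtain ⟨h, hh⟩ := ih hk.2
    obtain ⟨g, hg⟩ := exists_homeomorph_push hd hd1 (Ne.symm hk.1)
    refine ⟨h.trans g, fun x => ?_⟩
    obtain ⟨h1, h2, h3, h4⟩ := hh x
    obtain ⟨g1, g2, g3⟩ := hg (h x)
    have hxi : h x i = x i := h1 i hi (Ne.symm hk.1)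
    rw [Homeomorph.trans_apply]
    refine ⟨fun j hj hjk => ?_, fun j hjk => ?_, fun hx => ?_, fun hx j hj => ?_⟩
    · rw [Finset.mem_insert, not_or] at hj
      rw [g1 j hj.1 hjk, h1 j hj.2 hjk]
    · by_cases hji : j = i
      · subst hji; rwa [hxi] at g2
      · rw [g1 j hji hjk]; exact h2 j hjk
    · refine (g3 ?_).1
      rw [hxi]
      rcases hx with hx | ⟨j, hj, hx⟩
      · exact Or.inr (Or.inr (h3 (Or.inl hx)))
      · rcases Finset.mem_insert.1 hj with rfl | hj
        · tauto
        · exact Or.inr (Or.inr (h3 (Or.inr ⟨j, hj, hx⟩)))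
    · by_cases hji : j = i
      · subst hji
        exact (g3 (Or.inr (Or.inr (h3 (Or.inl hx))))).2
      · rw [g1 j hji fun h => (h ▸ not_or.2 hk) (Finset.mem_insert.1 hj)]
        exact h4 hx j ((Finset.mem_insert.1 hj).resolve_left hji)

/-- The faces of the cube in the directions `i < N` can be squeezed, by a small homeomorphism,
into a set whose coordinates `i < N` stay away from `0` and `1`. -/
theorem exists_homeomorph_squeeze_faces (N : ℕ) {d : ℝ} (hd : 0 < d) (hd1 : d ≤ 1 / 4) :
    ∃ h : HilbertCube ≃ₜ HilbertCube, ∀ x,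
      (∀ j < N, |(h x j : ℝ) - x j| ≤ 4 * d) ∧
      ((∃ i < N, (x i : ℝ) = 0 ∨ (x i : ℝ) = 1) →
        ∀ i < N, (h x i : ℝ) ∈ Set.Icc (d / 2) (1 - d / 2)) := by
  obtain ⟨h, hh⟩ := exists_homeomorph_push_finset (k := N) hd hd1 (Finset.range N) (by simp)
  refine ⟨h.trans h, fun x => ?_⟩
  obtain ⟨-, h2, h3, -⟩ := hh x
  obtain ⟨-, g2, -, g4⟩ := hh (h x)
  rw [Homeomorph.trans_apply]
  refine ⟨fun j hj => ?_, fun ⟨i, hi, hx⟩ j hj => ?_⟩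
  · linarith [abs_sub_le (h (h x) j : ℝ) (h x j) (x j), h2 j hj.ne, g2 j hj.ne]
  · exact g4 (h3 (Or.inr ⟨i, Finset.mem_range.2 hi, hx⟩)) j (Finset.mem_range.2 hj)

/-- The point whose first `M` coordinates are the coordinates `x s, …, x (s + M - 1)`, all
others being zero. -/
def window (s M : ℕ) (x : HilbertCube) : HilbertCube :=
  fun i => if i < M then x (s + i) else 0

theorem continuous_window (s M : ℕ) : Continuous (window s M) := by
  refine continuous_pi fun i => ?_
  unfold window
  split_ifs
  · exact continuous_apply _
  · exact continuous_const

theorem coordNear_window {m M : ℕ} (hmM : m ≤ M) {ε : ℝ} (hε : 0 < ε) (x : HilbertCube) :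
    CoordNear m ε (window 0 M x) x := fun i hi => by
  simpa [window, hi.trans_le hmM] using hε

/-- Klee's trick: on points whose first `2 * M` coordinates stay away from `0` and `1`, any
continuous map (of the first `M` coordinates) can be realised by a near-homeomorphism, which is
close to the identity if the map is. -/
theorem exists_isNearHomeo_eq_on_interior {f : HilbertCube → HilbertCube} (hf : Continuous f)
    (M : ℕ) {c : ℝ} (hc : 0 < c) (hc2 : c < 1 / 2) :
    ∃ φ : HilbertCube → HilbertCube, IsNearHomeo φ ∧
      (∀ x : HilbertCube, (∀ i < 2 * M, (x i : ℝ) ∈ Set.Icc c (1 - c)) →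
        ∀ i < M, φ x i = f (window 0 M x) i) ∧
      ∀ n ≤ M, ∀ ε : ℝ, (∀ z, CoordNear n ε (f z) z) → ∀ x, CoordNear n (ε + c) (φ x) x := by
  have hcmem : c ∈ Set.Ioo (0:ℝ) 1 := ⟨hc, by linarith⟩
  have hcmem' : 1 - c ∈ Set.Ioo (0:ℝ) 1 := ⟨by linarith, by linarith⟩
  let p : ℕ → HilbertCube → ℝ := fun i x => max c (min (1 - c) (x (M + i)))
  have hp : ∀ i x, p i x ∈ Set.Ioo (0:ℝ) 1 := fun i x =>
    ⟨lt_max_of_lt_left hc, max_lt hcmem.2 (min_lt_of_left_lt hcmem'.2)⟩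
  have hpc : ∀ i, Continuous (p i) := fun i => by fun_prop
  let q : ℕ → HilbertCube → ℝ := fun i x => f (window M M x) i
  have hq : ∀ i x, q i x ∈ Set.Icc (0:ℝ) 1 := fun i x => (f (window M M x) i).2
  have hqc : ∀ i, Continuous (q i) := fun i => by
    have := continuous_window M M
    fun_prop
  let C := bendMap (Finset.Ico M (2 * M)) (fun _ _ => c) (fun _ _ => 1 - c)
    (fun i x => x (i - M))
  let D := bendMap (Finset.range M) p p q
  have hC : IsNearHomeo C := by
    refine isNearHomeo_bendMap (fun _ => continuous_const) (fun _ => continuous_const)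
      (fun i => by fun_prop) (fun _ _ => hcmem) (fun _ _ => hcmem') (fun i x => (x (i - M)).2) ?_
    intro i hi x z h
    rw [Finset.mem_Ico] at hi
    exact ⟨rfl, rfl, by rw [h (i - M) (by simp; omega)]⟩
  have hD : IsNearHomeo D := by
    refine isNearHomeo_bendMap hpc hpc hqc hp hp hq ?_
    intro i _ x z h
    have h1 : ∀ j, x (M + j) = z (M + j) := fun j => h _ (by simp)
    have h2 : window M M x = window M M z := by
      funext j; simp only [window, h1]
    simp only [p, q, h1, h2, and_self]
  have hCfix : ∀ x, ∀ i < M, C x i = x i := fun x i hi =>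
    bendMap_apply_of_notMem (by simp; omega) x
  have hDval : ∀ x, ∀ i < M, (D x i : ℝ) = bend (p i x) (p i x) (q i x) (x i) := fun x i hi =>
    bendMap_apply_of_mem (Finset.mem_range.2 hi) (hp i x) (hp i x) (hq i x)
  refine ⟨D ∘ C, hD.comp hC, fun x hx i hi => ?_, fun n hn ε hfε x i hi => ?_⟩
  · have hcopy : ∀ j < M, C x (M + j) = x j := fun j hj => by
      ext
      have hmem : M + j ∈ Finset.Ico M (2 * M) := by simp; omega
      have := bendMap_apply_of_mem (l := fun _ _ => c) (r := fun _ _ => 1 - c)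
        (q := fun i x => x (i - M)) hmem (x := x) hcmem hcmem' (x (M + j - M)).2
      change (C x (M + j) : ℝ) = _ at this
      rw [this, bend_of_mem hc hcmem'.2 (hx _ (by omega)), Nat.add_sub_cancel_left]
    have hwin : window M M (C x) = window 0 M x := by
      funext j
      simp only [window, zero_add]
      split_ifs with hj
      · exact hcopy j hj
      · rfl
    have hpx : p i (C x) = x i := by
      have := hx i (by omega)
      simp only [p, hcopy i hi, min_eq_right this.2, max_eq_right this.1]
    ext
    rw [Function.comp_apply, hDval _ i hi, hCfix x i hi, hpx,
      bend_of_mem (hpx ▸ (hp i (C x)).1) (hpx ▸ (hp i (C x)).2) ⟨le_rfl, le_rfl⟩]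
    simp only [q, hwin]
  · have hiM := hi.trans_le hn
    have hb := abs_bend_sub_le (q := q i (C x)) (hp i (C x)).1 (hp i (C x)).2 (x i).2
    rw [Function.comp_apply, hDval _ i hiM, hCfix x i hiM]
    have h1 := hfε (window M M (C x)) i hi
    have h2 : window M M (C x) i = C x (M + i) := by simp [window, hiM]
    rw [h2] at h1
    have h3 : |(C x (M + i) : ℝ) - p i (C x)| ≤ c := by
      have h4 := (C x (M + i)).2
      simp only [p]
      rw [abs_le]
      constructor
      · have : max c (min (1 - c) (C x (M + i) : ℝ)) ≤ C x (M + i) + c :=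
          max_le (by linarith [h4.1]) ((min_le_right _ _).trans (by linarith))
        linarith
      · have : (C x (M + i) : ℝ) - c ≤ max c (min (1 - c) (C x (M + i) : ℝ)) :=
          le_max_of_le_right (le_min (by linarith [h4.2]) (by linarith))
        linarith
    have h5 := abs_sub_le (q i (C x)) (C x (M + i) : ℝ) (p i (C x))
    simp only [q] at h5 hb ⊢
    linarith

/-- Whether `f` maps a compact set into an open set is decided by finitely many coordinates. -/
theorem exists_window_bound {f : HilbertCube → HilbertCube} (hf : Continuous f)
    {K U : Set HilbertCube} (hK : IsCompact K) (hU : IsOpen U) (hKU : MapsTo f K U) :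
    ∃ M₀ : ℕ, ∀ M ≥ M₀, ∀ x ∈ K, ∀ z : HilbertCube,
      (∀ i < M, z i = f (window 0 M x) i) → z ∈ U := by
  obtain ⟨m, δ, hδ, hm⟩ := (hK.image hf).exists_coordNear_subset hU hKU.image_subset
  obtain ⟨m', δ', hδ', hm'⟩ := hf.exists_coordNear m hδ
  refine ⟨max m m', fun M hM x hx z hz => hm _ (mem_image_of_mem f hx) z fun i hi => ?_⟩
  rw [hz i (hi.trans_le ((le_max_left _ _).trans hM)), abs_sub_comm]
  exact hm' _ _ (coordNear_window ((le_max_right _ _).trans hM) hδ' x) i hi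

theorem IsZSet.exists_coordNear {F : Set HilbertCube} (hF : IsZSet F) (n : ℕ) {ε : ℝ}
    (hε : 0 < ε) :
    ∃ f : C(HilbertCube, HilbertCube), (∀ x, f x ∉ F) ∧ ∀ x, CoordNear n ε (f x) x := by
  obtain ⟨f, hfF, hf⟩ := hF.2 (Set.range fun y => interior {z | CoordNear n (ε / 2) z y})
    (by rintro _ ⟨y, rfl⟩; exact isOpen_interior) (by
      rw [sUnion_range, iUnion_eq_univ_iff]
      refine fun y => ⟨y, mem_interior_iff_mem_nhds.2 ?_⟩
      exact UniformSpace.mem_nhds_iff_symm.2 ⟨_, setOf_coordNear_mem_uniformity n (half_pos hε),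
        ⟨fun _ _ h => h.symm⟩, fun z hz => CoordNear.symm hz⟩)
  refine ⟨f, hfF, fun x => ?_⟩
  obtain ⟨_, ⟨y, rfl⟩, hx, hfx⟩ := hf x
  have := (interior_subset hfx : CoordNear n (ε / 2) (f x) y).trans
    (interior_subset hx : CoordNear n (ε / 2) x y).symm
  rwa [add_halves] at this

theorem isClosed_faces (N : ℕ) :
    IsClosed {x : HilbertCube | ∃ i < N, (x i : ℝ) = 0 ∨ (x i : ℝ) = 1} := by
  have : {x : HilbertCube | ∃ i < N, (x i : ℝ) = 0 ∨ (x i : ℝ) = 1} =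
      ⋃ i ∈ Finset.range N, {x : HilbertCube | (x i : ℝ) = 0 ∨ (x i : ℝ) = 1} := by
    ext x; simp
  rw [this]
  refine isClosed_biUnion_finset fun i _ => ?_
  have hi : Continuous fun x : HilbertCube => (x i : ℝ) := by fun_prop
  exact (isClosed_eq hi continuous_const).union (isClosed_eq hi continuous_const)

/-- A Z-set can be pushed off finitely many faces of the cube by a small homeomorphism. -/
theorem IsZSet.exists_homeomorph_disjoint_faces {F : Set HilbertCube} (hF : IsZSet F)
    (N n : ℕ) {ε : ℝ} (hε : 0 < ε) :
    ∃ h : HilbertCube ≃ₜ HilbertCube, (∀ x, CoordNear n ε (h x) x) ∧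
      ∀ x ∈ F, ∀ i < N, (h x i : ℝ) ≠ 0 ∧ (h x i : ℝ) ≠ 1 := by
  obtain ⟨f, hfF, hf⟩ := hF.exists_coordNear n (half_pos hε)
  obtain ⟨M₀, hM₀⟩ := exists_window_bound f.continuous isCompact_univ hF.1.isOpen_compl
    (fun x _ => hfF x)
  obtain ⟨M, hMM₀, hMn, hMN⟩ : ∃ M, M₀ ≤ M ∧ n ≤ M ∧ N ≤ 2 * M :=
    ⟨max M₀ (max n N), by omega, by omega, by omega⟩
  obtain ⟨d, hd, hd'⟩ : ∃ d : ℝ, 0 < d ∧ d < min (1 / 4) (ε / 20) :=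
    exists_between (lt_min (by norm_num) (by positivity))
  have hd1 := hd'.le.trans (min_le_left _ _)
  have hdε := hd'.trans_le (min_le_right _ _)
  obtain ⟨P, hP⟩ := exists_homeomorph_squeeze_faces (2 * M) hd hd1
  obtain ⟨φ, hφ, hφf, hφε⟩ := exists_isNearHomeo_eq_on_interior f.continuous M (half_pos hd)
    (by linarith)
  have hW := isClosed_faces (2 * M)
  obtain ⟨h, hh, hhε⟩ := (hφ.comp P.isNearHomeo).exists_homeomorph_mapsTo hW.isCompact
    hF.1.isOpen_compl (fun x hx => hM₀ M hMM₀ (P x) (mem_univ _) _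
      (hφf (P x) ((hP x).2 hx))) n (show 0 < ε / 20 by positivity)
  have hnear : ∀ x, CoordNear n ε (h x) x := fun x i hi => by
    have h1 := hhε x i hi
    have h2 := hφε n hMn _ hf (P x) i hi
    have h3 := (hP x).1 i (by omega)
    rw [Function.comp_apply] at h1
    have h4 := abs_sub_le (h x i : ℝ) (φ (P x) i) (x i)
    have h5 := abs_sub_le (φ (P x) i : ℝ) (P x i) (x i)
    linarith
  refine ⟨h.symm, fun x => ?_, fun x hx i hi => ?_⟩
  · simpa using (hnear (h.symm x)).symm
  · by_contra hcon
    rw [← not_or, not_not] at hcon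
    have := hh (show h.symm x ∈ _ from ⟨i, hi.trans_le hMN, hcon⟩)
    rw [Homeomorph.apply_symm_apply] at this
    exact this hx

theorem IsZSet.image_homeomorph {X : Type*} [TopologicalSpace X] {F : Set X} (hF : IsZSet F)
    (h : X ≃ₜ X) : IsZSet (h '' F) := by
  refine ⟨h.isClosedMap _ hF.1, fun U hU hcov => ?_⟩
  obtain ⟨f, hfF, hf⟩ := hF.2 ((fun V => h ⁻¹' V) '' U)
    (by rintro _ ⟨V, hV, rfl⟩; exact (hU V hV).preimage h.continuous) (by
      rw [sUnion_image, ← preimage_iUnion₂, ← sUnion_eq_biUnion, hcov, preimage_univ])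
  refine ⟨⟨fun x => h (f (h.symm x)), by fun_prop⟩, fun x => ?_, fun x => ?_⟩
  · rintro ⟨y, hy, hyx⟩
    exact hfF _ (h.injective hyx ▸ hy)
  · obtain ⟨_, ⟨V, hV, rfl⟩, hx, hfx⟩ := hf (h.symm x)
    exact ⟨V, hV, by simpa using hx, hfx⟩

/-- Tietze extension, keeping a map close to the identity. -/
theorem exists_extension_coordNear {F : Set HilbertCube} (hF : IsClosed F) (n : ℕ) {ε : ℝ}
    (hε : 0 < ε) (f₀ : C(F, HilbertCube)) (hf₀ : ∀ x : F, CoordNear n ε (f₀ x) x) :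
    ∃ f : C(HilbertCube, HilbertCube), (∀ x : F, f x = f₀ x) ∧
      ∀ x, CoordNear n (2 * ε) (f x) x := by
  have hext : ∀ i, ∃ D : C(HilbertCube, ℝ), (i < n → ∀ x, |D x| ≤ ε) ∧
      ∀ x : F, D x = f₀ x i - (x : HilbertCube) i := by
    intro i
    let D₀ : C(F, ℝ) := ⟨fun x => f₀ x i - (x : HilbertCube) i,
      (continuous_subtype_val.comp ((continuous_apply i).comp f₀.continuous)).sub
        (continuous_subtype_val.comp ((continuous_apply i).comp continuous_subtype_val))⟩
    by_cases hi : i < n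
    · obtain ⟨D, hD, hDr⟩ := D₀.exists_restrict_eq_forall_mem_of_closed (t := Set.Icc (-ε) ε)
        (fun x => abs_le.1 (hf₀ x i hi).le) ⟨0, by simpa using hε.le⟩ hF
      exact ⟨D, fun _ x => abs_le.2 (hD x), fun x => congrArg (fun g => g x) hDr⟩
    · obtain ⟨D, hDr⟩ := D₀.exists_restrict_eq hF
      exact ⟨D, fun h => absurd h hi, fun x => congrArg (fun g => g x) hDr⟩
  choose D hDε hD using hext
  refine ⟨⟨fun x i => Set.projIcc 0 1 zero_le_one (x i + D i x), ?_⟩, fun x => ?_,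
    fun x i hi => ?_⟩
  · exact continuous_pi fun i => continuous_projIcc.comp (by fun_prop)
  · funext i
    simp only [ContinuousMap.coe_mk, hD, add_sub_cancel]
    exact projIcc_val _ _
  · have h1 := (x i).2
    have h2 := abs_le.1 (hDε i hi x)
    have : |((Set.projIcc 0 1 zero_le_one (x i + D i x) : ↥(Set.Icc (0:ℝ) 1)) : ℝ) - x i| ≤ ε := by
      rw [coe_projIcc, abs_le]
      constructor
      · have : (x i : ℝ) - ε ≤ max 0 (min 1 (x i + D i x)) :=
          le_max_of_le_right (le_min (by linarith [h1.2]) (by linarith))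
        linarith
      · have : max 0 (min 1 ((x i : ℝ) + D i x)) ≤ x i + ε :=
          max_le (by linarith [h1.1]) ((min_le_right _ _).trans (by linarith))
        linarith
    change |((Set.projIcc 0 1 zero_le_one (x i + D i x) : ↥(Set.Icc (0:ℝ) 1)) : ℝ) - x i| < 2 * ε
    linarith

/-- A continuous map on a zero-dimensional compact space can be approximated by a continuous
map into a given dense set. -/
theorem exists_coordNear_mem_dense {X : Type*} [TopologicalSpace X] [CompactSpace X]
    {B : Set (Set X)} (hB : TopologicalSpace.IsTopologicalBasis B) (hclopen : ∀ s ∈ B, IsClopen s)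
    {G : Set HilbertCube} (hG : Dense G) {u : X → HilbertCube} (hu : Continuous u) (n : ℕ)
    {ε : ℝ} (hε : 0 < ε) :
    ∃ f : C(X, HilbertCube), ∀ x, f x ∈ G ∧ CoordNear n ε (f x) (u x) := by
  suffices h : ∃ t : Set X, IsClopen t ∧ Set.univ ⊆ t ∧
      ∃ f : C(X, HilbertCube), ∀ x ∈ t, f x ∈ G ∧ CoordNear n ε (f x) (u x) by
    obtain ⟨t, -, ht, f, hf⟩ := h
    exact ⟨f, fun x => hf x (ht (mem_univ x))⟩
  refine isCompact_univ.induction_on (p := fun s => ∃ t : Set X, IsClopen t ∧ s ⊆ t ∧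
      ∃ f : C(X, HilbertCube), ∀ x ∈ t, f x ∈ G ∧ CoordNear n ε (f x) (u x)) ?_ ?_ ?_ ?_
  · exact ⟨∅, isClopen_empty, subset_rfl, ContinuousMap.const X 0, fun x hx => hx.elim⟩
  · rintro s s' hss' ⟨t, ht, hst, h⟩
    exact ⟨t, ht, hss'.trans hst, h⟩
  · rintro s s' ⟨t, ht, hst, f, hf⟩ ⟨t', ht', hst', f', hf'⟩
    classical
    refine ⟨t ∪ t', ht.union ht', union_subset_union hst hst', ⟨t.piecewise f f', ?_⟩, ?_⟩
    · exact f.continuous.piecewise (by simp [ht.frontier_eq]) f'.continuous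
    · intro x hx
      by_cases hxt : x ∈ t
      · simpa [hxt] using hf x hxt
      · simpa [hxt] using hf' x (hx.resolve_left hxt)
  · intro x _
    have hnhds : ∀ y : HilbertCube, {z | CoordNear n (ε / 2) y z} ∈ 𝓝 y := fun y =>
      UniformSpace.ball_mem_nhds y (setOf_coordNear_mem_uniformity n (half_pos hε))
    obtain ⟨g, hg, hgG⟩ := hG.inter_nhds_nonempty (hnhds (u x))
    obtain ⟨t, htB, hxt, ht⟩ := hB.mem_nhds_iff.1 (hu.continuousAt (hnhds (u x)))
    refine ⟨t, mem_nhdsWithin_of_mem_nhds ((hB.isOpen htB).mem_nhds hxt), t, hclopen t htB,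
      subset_rfl, ContinuousMap.const X g, fun z hz => ⟨hg, ?_⟩⟩
    · have h1 : CoordNear n (ε / 2) (u x) g := hgG
      have h2 : CoordNear n (ε / 2) (u x) (u z) := ht hz
      have := h1.symm.trans h2
      rwa [add_halves] at this

theorem exists_icc_of_forall_ne {F : Set HilbertCube} (hF : IsCompact F) (N : ℕ)
    (h : ∀ x ∈ F, ∀ i < N, (x i : ℝ) ≠ 0 ∧ (x i : ℝ) ≠ 1) {δ : ℝ} (hδ : 0 < δ) :
    ∃ c : ℝ, 0 < c ∧ c < δ ∧ ∀ x ∈ F, ∀ i < N, (x i : ℝ) ∈ Set.Icc c (1 - c) := by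
  obtain ⟨m, ε, hε, hm⟩ := hF.exists_coordNear_subset (isClosed_faces N).isOpen_compl
    (fun x hx ⟨i, hi, hxi⟩ => by have := h x hx i hi; tauto)
  obtain ⟨c, hc, hcmin⟩ := exists_between (lt_min hε hδ)
  refine ⟨c, hc, hcmin.trans_le (min_le_right _ _), fun x hx i hi => ?_⟩
  have hcε := hcmin.trans_le (min_le_left _ _)
  have key : ∀ t : ↥(Set.Icc (0:ℝ) 1), (t : ℝ) = 0 ∨ (t : ℝ) = 1 → c ≤ |(x i : ℝ) - t| := by
    intro t ht
    by_contra! hlt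
    refine hm x hx (Function.update x i t) (fun j _ => ?_) ⟨i, hi, by simpa using ht⟩
    by_cases hj : j = i
    · subst hj; simpa using hlt.trans hcε
    · simpa [hj] using hε
  have h0 := key 0 (Or.inl rfl)
  have h1 := key 1 (Or.inr rfl)
  have hx := (x i).2
  simp only [Set.Icc.coe_zero, Set.Icc.coe_one, sub_zero, abs_of_nonneg hx.1] at h0 h1
  rw [abs_of_nonpos (by linarith [hx.2])] at h1
  exact ⟨h0, by linarith⟩

/-- A map of a Z-set into an open set which is close to the identity can be replaced by a
homeomorphism of the cube close to the identity. -/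
theorem IsZSet.exists_homeomorph_mapsTo {F G : Set HilbertCube} (hF : IsZSet F)
    (hG : IsOpen G) (n : ℕ) {ε : ℝ} (hε : 0 < ε) (f₀ : C(F, HilbertCube))
    (hf₀G : ∀ x, f₀ x ∈ G) (hf₀ : ∀ x : F, CoordNear n ε (f₀ x) x) :
    ∃ h : HilbertCube ≃ₜ HilbertCube, MapsTo h F G ∧ ∀ x, CoordNear n (5 * ε) (h x) x := by
  obtain ⟨f, hff₀, hf⟩ := exists_extension_coordNear hF.1 n hε f₀ hf₀
  obtain ⟨L, hL, hFL, hLG⟩ := exists_compact_between hF.1.isCompact (hG.preimage f.continuous)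
    (fun x hx => by simpa [hff₀ ⟨x, hx⟩] using hf₀G ⟨x, hx⟩)
  obtain ⟨m, δ, hδ, hm⟩ := hF.1.isCompact.exists_coordNear_subset isOpen_interior hFL
  obtain ⟨M₀, hM₀⟩ := exists_window_bound f.continuous hL hG hLG
  obtain ⟨h, hhδ, hhF⟩ := hF.exists_homeomorph_disjoint_faces (2 * max M₀ n) (max n m)
    (lt_min hδ hε)
  obtain ⟨c, hc, hcε, hcF⟩ := exists_icc_of_forall_ne (hF.1.isCompact.image h.continuous)
    (2 * max M₀ n) (forall_mem_image.2 hhF) (lt_min hε (show (0:ℝ) < 1 / 2 by norm_num))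
  obtain ⟨φ, hφ, hφf, hφε⟩ := exists_isNearHomeo_eq_on_interior f.continuous (max M₀ n) hc
    (hcε.trans_le (min_le_right _ _))
  obtain ⟨g, hg, hgε⟩ := hφ.exists_homeomorph_mapsTo (hF.1.isCompact.image h.continuous) hG
    (fun y hy => by
      obtain ⟨x, hx, rfl⟩ := hy
      refine hM₀ _ (le_max_left _ _) (h x) (interior_subset (hm x hx _ ?_)) _
        (hφf _ (hcF _ (mem_image_of_mem h hx)))
      exact ((hhδ x).mono (le_max_right _ _) (min_le_left _ _)).symm) n hε
  refine ⟨h.trans g, fun x hx => hg (mem_image_of_mem h hx), fun x => ?_⟩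
  have h1 := (hgε (h x)).trans (hφε n (le_max_right _ _) _ hf (h x))
  refine (h1.trans ((hhδ x).mono (le_max_left _ _) (min_le_right _ _))).mono le_rfl ?_
  linarith [hcε.trans_le (min_le_left _ _)]

/-- For every zero-dimensional Z-set `F` in the Hilbert cube and every dense open set
`G`, the set of homeomorphisms `h` with `h(F) ⊆ G` is dense in `H(I^ω)`. -/
theorem dense_homeos_mapping_into_dense_open (F G : Set HilbertCube)
    (hF : IsZSet F)
    (hzero : ∃ B : Set (Set ↥F),
      TopologicalSpace.IsTopologicalBasis B ∧ ∀ s ∈ B, IsClopen s)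
    (hGopen : IsOpen G) (hGdense : Dense G) :
    Dense {h : HilbertCube ≃ₜ HilbertCube | h '' F ⊆ G} := by
  obtain ⟨B, hB, hclopen⟩ := hzero
  have : CompactSpace F := isCompact_iff_compactSpace.1 hF.1.isCompact
  intro h₀
  rw [mem_closure_iff_nhds]
  intro s hs
  obtain ⟨n, ε, hε, hs'⟩ := exists_coordNear_of_mem_nhds_homeomorph hs
  obtain ⟨f, hf⟩ := exists_coordNear_mem_dense hB hclopen hGdense
    (h₀.continuous.comp (continuous_subtype_val (p := (· ∈ F)))) n (show 0 < ε / 5 by positivity)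
  have key : ∀ y : h₀ '' F, h₀ ((h₀.image F).symm y) = y := fun y =>
    congrArg Subtype.val ((h₀.image F).apply_symm_apply y)
  obtain ⟨g, hg, hgε⟩ := (hF.image_homeomorph h₀).exists_homeomorph_mapsTo hGopen n
    (show 0 < ε / 5 by positivity) (f.comp ⟨(h₀.image F).symm, (h₀.image F).symm.continuous⟩)
    (fun y => (hf _).1) (fun y => by simpa [key] using (hf ((h₀.image F).symm y)).2)
  refine ⟨h₀.trans g, hs' _ fun x => ?_, ?_⟩
  · have := (hgε (h₀ x)).symm
    rwa [mul_div_cancel₀ _ (by norm_num : (5 : ℝ) ≠ 0)] at this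
  · rintro _ ⟨x, hx, rfl⟩
    exact hg (mem_image_of_mem h₀ hx)
end
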